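/- arXiv:1705.10615 — 4 statements merged into one kernel-verified Lean document; each statement's English description precedes it below -/
import Mathlib

section
/- Let R be a commutative Noetherian semiperfect ring and C a semidualizing R-module. Let M be a finitely generated R-module satisfying: (i) M is C-stable and a C-syzygy; (ii) underline-Hom_R(Hom_R(C,M), C) = 0 = underline-Hom_R(λ(Hom_R(C,M)), C); (iii) the natural maps give isomorphisms M ≅ C ⊗_R Hom_R(C,M) and λ(Hom_R(C,M)) ≅ Hom_R(C, C ⊗_R λ(Hom_R(C,M))). Then M is horizontally linked with respect to C, i.e. M ≅ λ_R(C, λ_R(C,M)). -/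
/- Preliminary definitions for formalizing
   "Linkage of modules with respect to a semidualizing module"
   (Dibaei–Sadeghi). -/

open CategoryTheory

universe u
noncomputable section
namespace Paper

variable (R : Type u) [CommRing R]

/-- `Ext^i_R(M,N)`, realized via Mathlib's derived-functor `Ext` for the
`R`-linear abelian category of `R`-modules. -/
abbrev ExtGrp (M N : Type u) [AddCommGroup M] [Module R M] [AddCommGroup N] [Module R N]
    (i : ℕ) : Type u :=
  ((Ext R (ModuleCat.{u} R) i).obj (Opposite.op (ModuleCat.of R M))).obj (ModuleCat.of R N)

/-- `Tor^R_i(M,N)`. -/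
abbrev TorGrp (M N : Type u) [AddCommGroup M] [Module R M] [AddCommGroup N] [Module R N]
    (i : ℕ) : Type u :=
  ((Tor (ModuleCat.{u} R) i).obj (ModuleCat.of R M)).obj (ModuleCat.of R N)

/-- Local cohomology `H^i_I(M)`. -/
abbrev LocCoh (I : Ideal R) (i : ℕ) (M : Type u) [AddCommGroup M] [Module R M] : Type u :=
  (localCohomology I i).obj (ModuleCat.of R M)

/-- A commutative ring is semiperfect iff it is a finite direct product of
commutative local rings. -/
def IsSemiperfectRing : Prop :=
  ∃ (n : ℕ) (A : Fin n → Type u) (c : ∀ i, CommRing (A i)),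
    (∀ i, letI := c i; IsLocalRing (A i)) ∧
    (letI := c; Nonempty (R ≃+* ((i : Fin n) → A i)))

/-- `C` is a semidualizing `R`-module: `C` is finitely generated, the homothety map
`R → Hom_R(C,C)` is bijective, and `Ext^i_R(C,C) = 0` for all `i > 0`. -/
def IsSemidualizing (C : Type u) [AddCommGroup C] [Module R C] : Prop :=
  Module.Finite R C ∧
  Function.Bijective (LinearMap.lsmul R C) ∧
  ∀ i : ℕ, 0 < i → Subsingleton (ExtGrp R C C i)

/-- A minimal projective presentation `P₁ → P₀ → M → 0` of `M`:
both `P₀ → M` and the induced `P₁ → ker(P₀ → M)` are projective covers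
(surjections from finitely generated projectives with superfluous kernels). -/
structure MinPres (M : Type u) [AddCommGroup M] [Module R M] where
  P₁ : Type u
  P₀ : Type u
  [acg₁ : AddCommGroup P₁]
  [acg₀ : AddCommGroup P₀]
  [mod₁ : Module R P₁]
  [mod₀ : Module R P₀]
  f : P₁ →ₗ[R] P₀
  g : P₀ →ₗ[R] M
  finite₁ : Module.Finite R P₁
  finite₀ : Module.Finite R P₀
  proj₁ : Module.Projective R P₁
  proj₀ : Module.Projective R P₀
  surj : Function.Surjective g
  exact : LinearMap.range f = LinearMap.ker g
  min₀ : ∀ N : Submodule R P₀, N ⊔ LinearMap.ker g = ⊤ → N = ⊤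
  min₁ : ∀ N : Submodule R P₁, N ⊔ LinearMap.ker f = ⊤ → N = ⊤

attribute [instance] MinPres.acg₁ MinPres.acg₀ MinPres.mod₁ MinPres.mod₀

variable {R}

/-- Given a minimal presentation `P₁ --f--> P₀ → X → 0` this is
`Hom(f,C) : Hom_R(P₀,C) → Hom_R(P₁,C)`; its image is `Ω_C Tr_C X` and its
cokernel is the transpose `Tr_C X` of `X` with respect to `C`. -/
def MinPres.homC {X : Type u} [AddCommGroup X] [Module R X]
    (C : Type u) [AddCommGroup C] [Module R C] (pres : MinPres R X) :
    (pres.P₀ →ₗ[R] C) →ₗ[R] (pres.P₁ →ₗ[R] C) :=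
  LinearMap.lcomp R C pres.f

/-- `Tr_C X` computed from a given minimal presentation. -/
def MinPres.trC {X : Type u} [AddCommGroup X] [Module R X]
    (C : Type u) [AddCommGroup C] [Module R C] (pres : MinPres R X) : Type u :=
  (pres.P₁ →ₗ[R] C) ⧸ LinearMap.range (pres.homC C)

instance {X : Type u} [AddCommGroup X] [Module R X] (C : Type u) [AddCommGroup C] [Module R C]
    (pres : MinPres R X) : AddCommGroup (pres.trC C) :=
  inferInstanceAs (AddCommGroup ((pres.P₁ →ₗ[R] C) ⧸ LinearMap.range (pres.homC C)))

instance {X : Type u} [AddCommGroup X] [Module R X] (C : Type u) [AddCommGroup C] [Module R C]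
    (pres : MinPres R X) : Module R (pres.trC C) :=
  inferInstanceAs (Module R ((pres.P₁ →ₗ[R] C) ⧸ LinearMap.range (pres.homC C)))

variable (R)

/-- `N ≅ Ω_C Tr_C X` : `N` is (isomorphic to) the image of `Hom(f,C)` for a
minimal projective presentation `P₁ --f--> P₀ → X → 0` of `X`. -/
def IsOmegaTrC (C : Type u) [AddCommGroup C] [Module R C]
    (X : Type u) [AddCommGroup X] [Module R X]
    (N : Type u) [AddCommGroup N] [Module R N] : Prop :=
  ∃ pres : MinPres R X, Nonempty (N ≃ₗ[R] ↥(LinearMap.range (pres.homC C)))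

/-- `N ≅ λ_R(C,M) = Ω_C Tr_C (Hom_R(C,M))`. -/
def IsLambdaOf (C : Type u) [AddCommGroup C] [Module R C]
    (M : Type u) [AddCommGroup M] [Module R M]
    (N : Type u) [AddCommGroup N] [Module R N] : Prop :=
  IsOmegaTrC R C (C →ₗ[R] M) N

/-- `M` is horizontally linked with respect to `C` : `M ≅ λ_R(C, λ_R(C,M))`. -/
def IsHorizontallyLinked (C : Type u) [AddCommGroup C] [Module R C]
    (M : Type u) [AddCommGroup M] [Module R M] : Prop :=
  ∃ N : ModuleCat.{u} R, IsLambdaOf R C M N ∧ IsLambdaOf R C N M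

/-- `M` is horizontally linked in the sense of Martsinkovsky–Strooker:
`M ≅ λ(λ M)` where `λ = Ω Tr`. -/
def IsHorizontallyLinkedMS (M : Type u) [AddCommGroup M] [Module R M] : Prop :=
  ∃ N : ModuleCat.{u} R, IsOmegaTrC R R M N ∧ IsOmegaTrC R R N M

/-- `underline-Hom_R(M,N) = 0` : every homomorphism `M → N` factors through a
projective module. -/
def StableHomZero (M N : Type u) [AddCommGroup M] [Module R M]
    [AddCommGroup N] [Module R N] : Prop :=
  ∀ φ : M →ₗ[R] N, ∃ P : ModuleCat.{u} R, Module.Projective R P ∧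
    ∃ (α : M →ₗ[R] P) (β : (P : Type u) →ₗ[R] N), β ∘ₗ α = φ

/-- `M` is `C`-stable: `M` has no nonzero direct summand of the form `P ⊗_R C`
with `P` projective. -/
def IsCStable (C M : Type u) [AddCommGroup C] [Module R C]
    [AddCommGroup M] [Module R M] : Prop :=
  ∀ N₁ N₂ : Submodule R M, IsCompl N₁ N₂ →
    ∀ P : ModuleCat.{u} R, Module.Projective R P →
      Nonempty (↥N₁ ≃ₗ[R] TensorProduct R P C) → N₁ = ⊥

/-- `M` is a `C`-syzygy: `M` embeds into a module `P ⊗_R C` with `P` projective. -/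
def IsCSyzygy (C M : Type u) [AddCommGroup C] [Module R C]
    [AddCommGroup M] [Module R M] : Prop :=
  ∃ P : ModuleCat.{u} R, Module.Projective R P ∧
    ∃ ι : M →ₗ[R] TensorProduct R (P : Type u) C, Function.Injective ι

/-- Auxiliary recursion for `n`-th `C`-syzygies. -/
def IsNthCSyzygyAux (C : Type u) [AddCommGroup C] [Module R C] :
    ℕ → ModuleCat.{u} R → Prop
  | 0, _ => True
  | (m+1), M =>
    ∃ P : ModuleCat.{u} R, Module.Projective R P ∧
      ∃ ι : (M : Type u) →ₗ[R] TensorProduct R (P : Type u) C, Function.Injective ι ∧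
        IsNthCSyzygyAux C m
          (ModuleCat.of R (TensorProduct R (P : Type u) C ⧸ LinearMap.range ι))

/-- `M` is an `n`-th `C`-syzygy: there is an exact sequence
`0 → M → C₁ → ⋯ → C_n` with each `C_j` of the form `P_j ⊗_R C`, `P_j` projective. -/
def IsNthCSyzygy (n : ℕ) (C M : Type u) [AddCommGroup C] [Module R C]
    [AddCommGroup M] [Module R M] : Prop :=
  IsNthCSyzygyAux R C n (ModuleCat.of R M)

/-- The biduality map `M → Hom_R(Hom_R(M,C),C)`. -/
def bidualityMap (C M : Type u) [AddCommGroup C] [Module R C]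
    [AddCommGroup M] [Module R M] : M →ₗ[R] ((M →ₗ[R] C) →ₗ[R] C) :=
  (LinearMap.id : (M →ₗ[R] C) →ₗ[R] (M →ₗ[R] C)).flip

/-- `M` has `G_C`-dimension zero. -/
def GCdimZero (C M : Type u) [AddCommGroup C] [Module R C]
    [AddCommGroup M] [Module R M] : Prop :=
  Module.Finite R M ∧
  Function.Bijective (bidualityMap R C M) ∧
  (∀ i : ℕ, 0 < i → Subsingleton (ExtGrp R M C i)) ∧
  (∀ i : ℕ, 0 < i → Subsingleton (ExtGrp R (M →ₗ[R] C) C i))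

/-- `G_C`-dim`_R(M) ≤ n`: there is a resolution of `M` of length `≤ n` by modules of
`G_C`-dimension zero. -/
def GCdimLE (C M : Type u) [AddCommGroup C] [Module R C]
    [AddCommGroup M] [Module R M] (n : ℕ) : Prop :=
  ∃ (G : ℕ → ModuleCat.{u} R) (d : ∀ i : ℕ, (G (i+1) : Type u) →ₗ[R] G i)
    (ε : (G 0 : Type u) →ₗ[R] M),
    Function.Surjective ε ∧
    LinearMap.range (d 0) = LinearMap.ker ε ∧
    (∀ i : ℕ, LinearMap.range (d (i+1)) = LinearMap.ker (d i)) ∧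
    (∀ i : ℕ, GCdimZero R C (G i)) ∧
    (∀ i : ℕ, n < i → Subsingleton (G i))

/-- `G_C`-dim`_R(M) < ∞`. -/
def GCdimFinite (C M : Type u) [AddCommGroup C] [Module R C]
    [AddCommGroup M] [Module R M] : Prop :=
  ∃ n : ℕ, GCdimLE R C M n

/-- The "depth of `I` on `M`" (classical grade): `inf{ i | Ext^i_R(R/I, M) ≠ 0 }`,
as an extended natural number. -/
def edepth (I : Ideal R) (M : Type u) [AddCommGroup M] [Module R M] : ℕ∞ :=
  sInf {n : ℕ∞ | ∃ i : ℕ, n = i ∧ Nontrivial (ExtGrp R (R ⧸ I) M i)}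

/-- The depth of a module over a local ring. -/
def ldepth [IsLocalRing R] (M : Type u) [AddCommGroup M] [Module R M] : ℕ∞ :=
  edepth R (IsLocalRing.maximalIdeal R) M

/-- `depth_{R_p}(M_p)`. -/
def depthAt (p : Ideal R) [p.IsPrime] (M : Type u) [AddCommGroup M] [Module R M] : ℕ∞ :=
  ldepth (Localization.AtPrime p) (LocalizedModule p.primeCompl M)

/-- `depth R_p`. -/
def ringDepthAt (p : Ideal R) [p.IsPrime] : ℕ∞ :=
  ldepth (Localization.AtPrime p) (Localization.AtPrime p)

/-- Serre's condition `(S̃_n)`: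
`depth_{R_p}(M_p) ≥ min{n, depth R_p}` for all primes `p`. -/
def SerreTilde (n : ℕ) (M : Type u) [AddCommGroup M] [Module R M] : Prop :=
  ∀ (p : Ideal R) (_ : p.IsPrime), min (n : ℕ∞) (ringDepthAt R p) ≤ depthAt R p M

/-- Serre's condition `(S_n)`:
`depth_{R_p}(M_p) ≥ min{n, dim R_p}` for all primes `p`. -/
def SerreS (n : ℕ) (M : Type u) [AddCommGroup M] [Module R M] : Prop :=
  ∀ (p : Ideal R) (_ : p.IsPrime),
    min (n : WithBot ℕ∞) (ringKrullDim (Localization.AtPrime p)) ≤ (depthAt R p M : WithBot ℕ∞)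

/-- The dimension of a module: `dim_R(M) = dim (R / ann_R M)`. -/
def moduleDim (M : Type u) [AddCommGroup M] [Module R M] : WithBot ℕ∞ :=
  ringKrullDim (R ⧸ Module.annihilator R M)

/-- A Cohen-Macaulay module over a local ring: `depth_R(M) = dim_R(M)`. -/
def IsCMModule [IsLocalRing R] (M : Type u) [AddCommGroup M] [Module R M] : Prop :=
  (ldepth R M : WithBot ℕ∞) = moduleDim R M

/-- A maximal Cohen-Macaulay module over a local ring: `depth_R(M) = dim R`. -/
def IsMaximalCM [IsLocalRing R] (M : Type u) [AddCommGroup M] [Module R M] : Prop :=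
  (ldepth R M : WithBot ℕ∞) = ringKrullDim R

/-- A Cohen-Macaulay local ring. -/
def IsCMLocalRing : Prop :=
  ∃ _ : IsLocalRing R, (ldepth R R : WithBot ℕ∞) = ringKrullDim R

/-- `C` has finite injective dimension: for some `n`, `Ext^i_R(-,C)` vanishes
for all `i > n`. -/
def HasFiniteInjDim (C : Type u) [AddCommGroup C] [Module R C] : Prop :=
  ∃ n : ℕ, ∀ (M : ModuleCat.{u} R) (i : ℕ), n < i →
    Subsingleton (((Ext R (ModuleCat.{u} R) i).obj (Opposite.op M)).obj (ModuleCat.of R C))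

/-- `ω` is a canonical module of `R`: a semidualizing module of finite injective
dimension. -/
def IsCanonicalModule (ω : Type u) [AddCommGroup ω] [Module R ω] : Prop :=
  IsSemidualizing R ω ∧ HasFiniteInjDim R ω

/-- `Gid_R(M) ≤ n`: there is an exact complex `⋯ → I_1 → I_0 → I_{-1} → ⋯` of
injective modules, which stays exact under `Hom_R(E,-)` for every injective `E`,
with `M ≅ ker(I_0 → I_{-1})` and `I_j = 0` for `j < -n`. -/
def GidLE (M : Type u) [AddCommGroup M] [Module R M] (n : ℕ) : Prop :=
  ∃ (I : ℤ → ModuleCat.{u} R) (d : ∀ i : ℤ, (I (i+1) : Type u) →ₗ[R] I i),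
    (∀ i : ℤ, Module.Injective R (I i)) ∧
    (∀ i : ℤ, LinearMap.range (d (i+1)) = LinearMap.ker (d i)) ∧
    (∀ E : ModuleCat.{u} R, Module.Injective R E →
      ∀ (i : ℤ) (φ : (E : Type u) →ₗ[R] I (i+1)), d i ∘ₗ φ = 0 →
        ∃ ψ : (E : Type u) →ₗ[R] I (i+1+1), d (i+1) ∘ₗ ψ = φ) ∧
    Nonempty (M ≃ₗ[R] ↥(LinearMap.ker (d (-1)))) ∧
    (∀ i : ℤ, i < -(n : ℤ) → Subsingleton (I i))

/-- `M` has finite Gorenstein injective dimension. -/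
def HasFiniteGid (M : Type u) [AddCommGroup M] [Module R M] : Prop :=
  ∃ n : ℕ, GidLE R M n

/-- The evaluation map `C ⊗_R Hom_R(C,M) → M`. -/
def evalMap (C M : Type u) [AddCommGroup C] [Module R C]
    [AddCommGroup M] [Module R M] : TensorProduct R C (C →ₗ[R] M) →ₗ[R] M :=
  TensorProduct.lift ((LinearMap.id : (C →ₗ[R] M) →ₗ[R] (C →ₗ[R] M)).flip)

/-- Membership in the Bass class `B_C`. -/
def MemBass (C M : Type u) [AddCommGroup C] [Module R C]
    [AddCommGroup M] [Module R M] : Prop :=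
  Function.Bijective (evalMap R C M) ∧
  (∀ i : ℕ, 0 < i → Subsingleton (TorGrp R (C →ₗ[R] M) C i)) ∧
  (∀ i : ℕ, 0 < i → Subsingleton (ExtGrp R C M i))

/-- Membership in the Auslander class `A_C`. -/
def MemAus (C M : Type u) [AddCommGroup C] [Module R C]
    [AddCommGroup M] [Module R M] : Prop :=
  Function.Bijective (TensorProduct.mk R M C) ∧
  (∀ i : ℕ, 0 < i → Subsingleton (TorGrp R M C i)) ∧
  (∀ i : ℕ, 0 < i → Subsingleton (ExtGrp R C (TensorProduct R M C) i))

/-- The grade of a module: the common length of maximal `R`-regular sequences in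
`ann_R(M)`, i.e. `inf{ i | Ext^i(R/ann M, R) ≠ 0 }`. -/
def gradeMod (M : Type u) [AddCommGroup M] [Module R M] : ℕ∞ :=
  edepth R (Module.annihilator R M) R

/-- The grade of an ideal `I`, i.e. `grade_R(R/I)`. -/
def gradeIdeal (I : Ideal R) : ℕ∞ :=
  edepth R I R

/-- An unmixed ideal: every associated prime of `R/I` is a minimal prime of `I`. -/
def IsUnmixedIdeal (I : Ideal R) : Prop :=
  ∀ p ∈ associatedPrimes R (R ⧸ I), p ∈ I.minimalPrimes

/-- Equality of the `a`-th Bass number of `R` (over `R`, w.r.t. the maximal ideal `m`)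
and the `b`-th Bass number of `A` (over `A`, w.r.t. the maximal ideal `mA`): both Ext
modules are vector spaces over the corresponding residue fields of one and the same
dimension. -/
def BassNumbersEq (m : Ideal R) (a : ℕ) (A : Type u) [CommRing A] (mA : Ideal A) (b : ℕ) : Prop :=
  ∃ ι : Type u,
    Nonempty (ExtGrp R (R ⧸ m) R a ≃ₗ[R] (ι →₀ (R ⧸ m))) ∧
    Nonempty (ExtGrp A (A ⧸ mA) A b ≃ₗ[A] (ι →₀ (A ⧸ mA)))

/-- A quasi-Gorenstein ideal of a local ring `R`: `G-dim_R(R/a) < ∞` and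
`μ^{i+depth R}_R(R) = μ^{i+depth R/a}_{R/a}(R/a)` for all `i ≥ 0`. -/
def IsQuasiGorensteinIdeal [IsLocalRing R] (a : Ideal R) : Prop :=
  GCdimFinite R R (R ⧸ a) ∧
  ∀ i : ℕ,
    BassNumbersEq R (IsLocalRing.maximalIdeal R) (i + (ldepth R R).toNat)
      (R ⧸ a) (Ideal.map (Ideal.Quotient.mk a) (IsLocalRing.maximalIdeal R))
      (i + (edepth (R ⧸ a) (Ideal.map (Ideal.Quotient.mk a) (IsLocalRing.maximalIdeal R))
        (R ⧸ a)).toNat)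

/-- `E` is an injective hull of `K`: `E` is injective and contains a copy of `K`
as an essential submodule. -/
def IsInjectiveHull (K E : Type u) [AddCommGroup K] [Module R K]
    [AddCommGroup E] [Module R E] : Prop :=
  Module.Injective R E ∧
  ∃ ι : K →ₗ[R] E, Function.Injective ι ∧
    ∀ N : Submodule R E, N ≠ ⊥ → N ⊓ LinearMap.range ι ≠ ⊥

/-- A generalized Cohen-Macaulay module over a local ring: `dim M ≥ 1` and
`H^i_m(M)` has finite length for all `i < dim M`. -/
def IsGeneralizedCM [IsLocalRing R] (M : Type u) [AddCommGroup M] [Module R M] : Prop :=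
  1 ≤ moduleDim R M ∧
  ∀ i : ℕ, (i : WithBot ℕ∞) < moduleDim R M →
    IsFiniteLength R (LocCoh R (IsLocalRing.maximalIdeal R) i M)

end Paper

lemma exists_idempotents_of_isSemiperfectRing {R : Type u} [CommRing R]
    (h : Paper.IsSemiperfectRing R) :
    ∃ (n : ℕ) (e : Fin n → R) (m : Fin n → Ideal R),
      (∀ i, (m i).IsMaximal) ∧ (∑ i, e i = 1) ∧ (∀ i, e i * e i = e i) ∧
      (∀ i, 1 - e i ∈ m i) ∧ (∀ i k, k ≠ i → e k ∈ m i) ∧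
      (∀ i, ∀ x ∈ m i, x * e i ∈ Ideal.jacobson (⊥ : Ideal R)) ∧
      (∀ i, ∀ r ∉ m i, ∃ s, s * r * e i = e i) := by
  classical
  obtain ⟨n, A, _, hA, ⟨c⟩⟩ := h
  have hc (i : Fin n) (r : R) :
      r ∈ (IsLocalRing.maximalIdeal (A i)).comap ((Pi.evalRingHom A i).comp c.toRingHom) ↔
        ¬ IsUnit (c r i) := by
    simp [Ideal.mem_comap]
  refine ⟨n, fun i => c.symm (Pi.single i 1),
    fun i => (IsLocalRing.maximalIdeal (A i)).comap ((Pi.evalRingHom A i).comp c.toRingHom),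
    ?_, ?_, ?_, ?_, ?_, ?_, ?_⟩
  · intro i
    exact Ideal.comap_isMaximal_of_surjective _
      ((Function.surjective_eval i).comp c.surjective)
  · rw [← map_sum, RingEquiv.symm_apply_eq, map_one]
    exact Finset.univ_sum_single (1 : ∀ i, A i)
  · intro i
    rw [← map_mul, ← Pi.single_mul, one_mul]
  · intro i
    simp
  · intro i k hik
    rw [hc]
    simp [Pi.single_eq_of_ne (Ne.symm hik)]
  · intro i x hx
    rw [hc] at hx
    rw [Ideal.mem_jacobson_bot]
    intro y
    rw [← MulEquiv.isUnit_map c, Pi.isUnit_iff]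
    intro k
    by_cases hik : k = i
    · subst hik
      have h1 : c x k * c y k ∈ IsLocalRing.maximalIdeal (A k) :=
        Ideal.mul_mem_right _ _ ((IsLocalRing.mem_maximalIdeal _).2 hx)
      have := IsLocalRing.isUnit_one_sub_self_of_mem_nonunits _ (neg_mem h1)
      simpa [add_comm] using this
    · simp [Pi.single_eq_of_ne hik]
  · intro i r hr
    rw [hc, not_not] at hr
    obtain ⟨u, hu⟩ := hr
    refine ⟨c.symm (Pi.single i (↑u⁻¹ : A i)), c.injective ?_⟩
    funext k
    by_cases hik : k = i
    · subst hik
      simp [← hu]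
    · simp [Pi.single_eq_of_ne hik]

lemma exists_lift_basis_quotient {R : Type*} [CommRing R] (m : Ideal R) [m.IsMaximal]
    (Y : Type*) [AddCommGroup Y] [Module R Y] [Module.Finite R Y] :
    ∃ (d : ℕ) (y : Fin d → Y),
      (∀ z, ∃ r : Fin d → R, z - ∑ j, r j • y j ∈ m • (⊤ : Submodule R Y)) ∧
      (∀ r : Fin d → R, ∑ j, r j • y j ∈ m • (⊤ : Submodule R Y) → ∀ j, r j ∈ m) := by
  let := Ideal.Quotient.field m
  let V := Y ⧸ (m • (⊤ : Submodule R Y))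
  have : Module.Finite (R ⧸ m) V := Module.Finite.of_restrictScalars_finite R _ _
  let b := Module.finBasis (R ⧸ m) V
  choose y hy using fun j => Submodule.mkQ_surjective _ (b j)
  have key (r : Fin _ → R) : (m • (⊤ : Submodule R Y)).mkQ (∑ j, r j • y j) =
      ∑ j, (Ideal.Quotient.mk m (r j)) • b j := by
    simp only [map_sum, map_smul, hy]
    rfl
  refine ⟨_, y, fun z => ?_, fun r hr j => ?_⟩
  · choose r hr using fun j => Ideal.Quotient.mk_surjective
      (b.repr ((m • (⊤ : Submodule R Y)).mkQ z) j)
    refine ⟨r, ?_⟩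
    rw [← Submodule.Quotient.mk_eq_zero, ← Submodule.mkQ_apply, map_sub, key]
    simp only [hr, b.sum_repr, sub_self]
  · rw [← Submodule.Quotient.mk_eq_zero, ← Submodule.mkQ_apply, key] at hr
    exact Ideal.Quotient.eq_zero_iff_mem.1
      (Fintype.linearIndependent_iff.1 b.linearIndependent _ hr j)

lemma projective_span_singleton_of_mul_self {R : Type*} [CommRing R] {e : R} (he : e * e = e) :
    Module.Projective R (Ideal.span {e}) := by
  refine .of_split (Ideal.span {e}).subtype
    (LinearMap.toSpanSingleton R _ ⟨e, Ideal.mem_span_singleton_self e⟩) ?_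
  ext ⟨x, hx⟩
  obtain ⟨a, rfl⟩ := Ideal.mem_span_singleton'.1 hx
  simp [mul_assoc, he]

lemma eq_top_of_sup_eq_top_of_le_jacobson_smul {R P : Type*} [CommRing R] [AddCommGroup P]
    [Module R P] [Module.Finite R P] {N K : Submodule R P}
    (hK : K ≤ Ideal.jacobson (⊥ : Ideal R) • (⊤ : Submodule R P)) (h : N ⊔ K = ⊤) : N = ⊤ :=
  top_le_iff.1 <| Submodule.le_of_le_smul_of_le_jacobson_bot Module.Finite.fg_top le_rfl
    (h.ge.trans (sup_le_sup_left hK N))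

lemma exists_projective_cover {R : Type u} [CommRing R] (h : Paper.IsSemiperfectRing R)
    (Y : Type u) [AddCommGroup Y] [Module R Y] [Module.Finite R Y] :
    ∃ (P : Type u) (_ : AddCommGroup P) (_ : Module R P) (g : P →ₗ[R] Y),
      Module.Finite R P ∧ Module.Projective R P ∧ Function.Surjective g ∧
      ∀ N : Submodule R P, N ⊔ LinearMap.ker g = ⊤ → N = ⊤ := by
  obtain ⟨n, e, m, hm, hsum, hidem, hone, hne, hjac, -⟩ :=
    exists_idempotents_of_isSemiperfectRing h
  choose d y hy hy' using fun i => exists_lift_basis_quotient (m i) Y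
  let ι := Σ i, Fin (d i)
  have hproj (i) : Module.Projective R (Ideal.span {e i}) :=
    projective_span_singleton_of_mul_self (hidem i)
  have hfin (i) : Module.Finite R (Ideal.span {e i}) :=
    Module.Finite.of_fg (Submodule.fg_span_singleton _)
  let P := ∀ q : ι, Ideal.span {e q.1}
  have hP : Module.Projective R P := .of_equiv (DFinsupp.linearEquivFunOnFintype (R := R) (M := fun q : ι => Ideal.span {e q.1}))
  let g : P →ₗ[R] Y :=
    ∑ q : ι, (LinearMap.toSpanSingleton R Y (y q.1 q.2)) ∘ₗ (Ideal.span {e q.1}).subtype ∘ₗ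
      LinearMap.proj q
  have hg (a : P) : g a = ∑ i, ∑ j, (a ⟨i, j⟩ : R) • y i j := by
    simp only [g, LinearMap.sum_apply]
    rw [Fintype.sum_sigma]
    rfl
  have hmul (i) (a : Ideal.span {e i}) : (a : R) * e i = a := by
    obtain ⟨b, hb⟩ := Ideal.mem_span_singleton'.1 a.2
    rw [← hb, mul_assoc, hidem]
  have hsm (i) (z : Y) (hz : z ∈ m i • (⊤ : Submodule R Y)) :
      e i • z ∈ Ideal.jacobson (⊥ : Ideal R) • (⊤ : Submodule R Y) := by
    induction hz using Submodule.smul_induction_on' with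
    | smul r hr z _ =>
      rw [smul_smul, mul_comm]
      exact Submodule.smul_mem_smul (hjac i r hr) trivial
    | add a _ b _ ha hb => rw [smul_add]; exact add_mem ha hb
  refine ⟨P, inferInstance, inferInstance, g, inferInstance, hP, ?_, fun N hN => ?_⟩
  · rw [← LinearMap.range_eq_top]
    refine top_le_iff.1 <| Submodule.le_of_le_smul_of_le_jacobson_bot Module.Finite.fg_top le_rfl ?_
    intro z _
    choose r hr using fun i => hy i z
    have hz : z = g (fun q => ⟨r q.1 q.2 * e q.1, Ideal.mem_span_singleton'.2 ⟨_, rfl⟩⟩) +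
        ∑ i, e i • (z - ∑ j, r i j • y i j) := by
      rw [hg, ← Finset.sum_add_distrib]
      simp only [smul_sub, Finset.smul_sum, smul_smul, mul_comm]
      simp [← Finset.sum_smul, hsum]
    rw [hz]
    exact Submodule.add_mem_sup ⟨_, rfl⟩ (Submodule.sum_mem _ fun i _ => hsm i _ (hr i))
  · refine eq_top_of_sup_eq_top_of_le_jacobson_smul ?_ hN
    intro a ha
    have hmem (i) (j) : (a ⟨i, j⟩ : R) ∈ m i := by
      refine hy' i (fun j => a ⟨i, j⟩) ?_ j
      have h0 : ∑ i, ∑ j, (a ⟨i, j⟩ : R) • y i j = 0 := by rw [← hg]; exact ha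
      rw [← Finset.add_sum_erase _ _ (Finset.mem_univ i)] at h0
      rw [eq_neg_of_add_eq_zero_left h0]
      refine neg_mem (Submodule.sum_mem _ fun k hk => Submodule.sum_mem _ fun l _ => ?_)
      rw [← hmul k (a ⟨k, l⟩)]
      exact Submodule.smul_mem_smul
        (Ideal.mul_mem_left _ _ (hne i k (Finset.ne_of_mem_erase hk))) trivial
    classical
    have : a = ∑ q : ι, (a q : R) • Pi.single q (⟨e q.1, Ideal.mem_span_singleton_self _⟩ :
        Ideal.span {e q.1}) := by
      refine funext fun q => Subtype.ext ?_
      rw [Finset.sum_apply, Finset.sum_eq_single q]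
      · simp [hmul]
      · intro k _ hk
        simp [Pi.single_eq_of_ne hk.symm]
      · simp
    rw [this]
    refine Submodule.sum_mem _ fun q _ => Submodule.smul_mem_smul ?_ trivial
    rw [← hmul]
    exact hjac _ _ (hmem q.1 q.2)

open TensorProduct in
lemma Paper.StableHomZero.dualTensorHom_surjective {R : Type u} [CommRing R]
    {X C : Type u} [AddCommGroup X] [Module R X] [Module.Finite R X] [AddCommGroup C] [Module R C]
    (h : Paper.StableHomZero R X C) : Function.Surjective (dualTensorHom R X C) := by
  intro φ
  obtain ⟨P, hP, α, β, rfl⟩ := h φ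
  obtain ⟨t, rfl⟩ := (dualTensorHom_bijective_of_finite_left_projective_right
    (R := R) (M := X) (N := P)).2 α
  exact ⟨β.lTensor _ t, LinearMap.congr_fun (dualTensorHom_comp_lTensor β) t⟩

lemma LinearMap.exists_eq_comp_of_surjective_of_ker_le {R A B D : Type*} [CommRing R]
    [AddCommGroup A] [Module R A] [AddCommGroup B] [Module R B] [AddCommGroup D] [Module R D]
    {g : A →ₗ[R] B} (hg : Function.Surjective g) {φ : A →ₗ[R] D}
    (h : LinearMap.ker g ≤ LinearMap.ker φ) : ∃ ψ : B →ₗ[R] D, φ = ψ ∘ₗ g := by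
  refine ⟨(LinearMap.ker g).liftQ φ h ∘ₗ (g.quotKerEquivOfSurjective hg).symm, ?_⟩
  ext a
  have : (g.quotKerEquivOfSurjective hg).symm (g a) = (LinearMap.ker g).mkQ a := by
    rw [LinearEquiv.symm_apply_eq]; rfl
  simp [this]

open TensorProduct in
lemma Paper.IsCSyzygy.eq_zero_of_forall_dual {R : Type u} [CommRing R] {C M : Type u}
    [AddCommGroup C] [Module R C] [AddCommGroup M] [Module R M]
    (hC : Function.Bijective (LinearMap.lsmul R C)) (h : Paper.IsCSyzygy R C M)
    (x : C →ₗ[R] M) (hx : ∀ χ : Module.Dual R (C →ₗ[R] M), χ x = 0) : x = 0 := by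
  obtain ⟨P, hP, ι, hι⟩ := h
  obtain ⟨s, hs⟩ := Module.projective_def'.1 hP
  classical
  let γ : P ⊗[R] C →ₗ[R] (P →₀ C) :=
    (TensorProduct.finsuppScalarLeft R C P).toLinearMap ∘ₗ s.rTensor C
  have hγ : Function.Injective γ := by
    refine (TensorProduct.finsuppScalarLeft R C P).injective.comp
      (LinearMap.injective_of_comp_eq_id _ ((Finsupp.linearCombination R id).rTensor C) ?_)
    rw [← LinearMap.rTensor_comp, hs, LinearMap.rTensor_id]
  let E := LinearEquiv.ofBijective (LinearMap.lsmul R C) hC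
  ext c
  refine hι (hγ ?_)
  rw [LinearMap.zero_apply, map_zero, map_zero]
  ext q
  let δ : M →ₗ[R] C := Finsupp.lapply q ∘ₗ γ ∘ₗ ι
  have h0 : E.symm (δ ∘ₗ x) = 0 := hx (E.symm.toLinearMap ∘ₗ LinearMap.compRight R δ)
  rw [LinearEquiv.map_eq_zero_iff] at h0
  exact LinearMap.congr_fun h0 c

open TensorProduct in
lemma Paper.IsCStable.eq_zero_of_idempotent {R : Type u} [CommRing R] {C M : Type u}
    [AddCommGroup C] [Module R C] [AddCommGroup M] [Module R M]
    (hC : Function.Injective (LinearMap.lsmul R C)) (h : Paper.IsCStable R C M)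
    (hM : Function.Bijective (Paper.evalMap R C M)) (χ : Module.Dual R (C →ₗ[R] M))
    (x : C →ₗ[R] M) {e s : R} (he : e * e = e) (hs : s * χ x * e = e) : e = 0 := by
  let E := Ideal.span {e}
  have hE : Module.Projective R E := projective_span_singleton_of_mul_self he
  let e' : E := ⟨e, Ideal.mem_span_singleton_self e⟩
  let ev := LinearEquiv.ofBijective _ hM
  let ψ : (C →ₗ[R] M) →ₗ[R] E := LinearMap.toSpanSingleton R E e' ∘ₗ χ
  let σ : E →ₗ[R] (C →ₗ[R] M) := LinearMap.toSpanSingleton R _ (s • x) ∘ₗ E.subtype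
  have hψσ : ψ ∘ₗ σ = LinearMap.id := by
    ext ⟨z, hz⟩
    obtain ⟨a, rfl⟩ := Ideal.mem_span_singleton'.1 hz
    simp only [ψ, σ, e', LinearMap.comp_apply, LinearMap.toSpanSingleton_apply,
      Submodule.subtype_apply, map_smul, LinearMap.id_apply, SetLike.val_smul, smul_eq_mul]
    linear_combination a * e * hs + a * he
  let p : M →ₗ[R] C ⊗[R] E := ψ.lTensor C ∘ₗ ev.symm.toLinearMap
  let i : C ⊗[R] E →ₗ[R] M := ev.toLinearMap ∘ₗ σ.lTensor C
  have hpi (t) : p (i t) = t := by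
    have : ψ.lTensor C (σ.lTensor C t) = t := by
      rw [← LinearMap.lTensor_comp_apply, hψσ, LinearMap.lTensor_id_apply]
    simpa [p, i] using this
  have hi : Function.Injective i := Function.LeftInverse.injective hpi
  have hcompl : IsCompl (LinearMap.range i) (LinearMap.ker (i.rangeRestrict ∘ₗ p)) := by
    refine LinearMap.isCompl_of_proj ?_
    rintro ⟨_, t, rfl⟩
    exact Subtype.ext (congrArg i (hpi t))
  have hbot := h _ _ hcompl (ModuleCat.of R E) hE
    ⟨(LinearEquiv.ofInjective i hi).symm ≪≫ₗ TensorProduct.comm R C E⟩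
  rw [LinearMap.range_eq_bot] at hbot
  refine hC ?_
  ext c
  have h0 : c ⊗ₜ[R] e' = 0 := hi (by rw [hbot]; simp)
  have := congrArg (TensorProduct.lift (LinearMap.lsmul R C).flip ∘ₗ E.subtype.lTensor C) h0
  simpa [e'] using this

lemma Module.Dual.mem_ideal_smul_top {R P : Type*} [CommRing R] [AddCommGroup P] [Module R P]
    [Module.Finite R P] [Module.Projective R P] {J : Ideal R} {φ : Module.Dual R P}
    (h : ∀ p, φ p ∈ J) : φ ∈ J • (⊤ : Submodule R (Module.Dual R P)) := by
  obtain ⟨n, f, g, -, -, hfg⟩ := Module.Finite.exists_comp_eq_id_of_projective R P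
  have : φ = ∑ i, φ (f (Pi.single i 1)) • (LinearMap.proj i ∘ₗ g) := by
    ext p
    conv_lhs => rw [← LinearMap.id_apply (R := R) p, ← hfg, LinearMap.comp_apply,
      pi_eq_sum_univ' (g p)]
    simp [mul_comm, Pi.single]
  rw [this]
  exact Submodule.sum_mem _ fun i _ => Submodule.smul_mem_smul (h _) trivial

open TensorProduct in
/-- If `P₁ → P₀ → X → 0` is exact with `P₀`, `P₁` finite projective and every map `X → C` comes
from `X* ⊗ C`, then tensoring the image `L` of `P₀* → P₁*` with `C` gives the image of
`Hom(P₀, C) → Hom(P₁, C)`. -/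
lemma exists_tensor_equiv_range_lcomp_of_dualMap_eq {R C P₀ P₁ X L : Type*} [CommRing R]
    [AddCommGroup C] [Module R C]
    [AddCommGroup P₀] [Module R P₀] [Module.Finite R P₀] [Module.Projective R P₀]
    [AddCommGroup P₁] [Module R P₁] [Module.Finite R P₁] [Module.Projective R P₁]
    [AddCommGroup X] [Module R X] [AddCommGroup L] [Module R L]
    {f : P₁ →ₗ[R] P₀} {g : P₀ →ₗ[R] X}
    (hg : Function.Surjective g) (hfg : LinearMap.range f = LinearMap.ker g)
    (hX : Function.Surjective (dualTensorHom R X C))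
    {r : Module.Dual R P₀ →ₗ[R] L} (hr : Function.Surjective r)
    {j : L →ₗ[R] Module.Dual R P₁} (hj : Function.Injective j) (hjr : j ∘ₗ r = f.dualMap) :
    Nonempty (L ⊗[R] C ≃ₗ[R] LinearMap.range (f.lcomp R C)) := by
  let Φ := dualTensorHom R P₁ C ∘ₗ j.rTensor C
  have hrC : Function.Surjective (r.rTensor C) := LinearMap.rTensor_surjective C hr
  have hΦ : Φ ∘ₗ r.rTensor C = f.lcomp R C ∘ₗ dualTensorHom R P₀ C := by
    rw [← dualTensorHom_comp_rTensor_dualMap, LinearMap.comp_assoc, ← LinearMap.rTensor_comp, hjr]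
  have hinj : Function.Injective Φ := by
    rw [injective_iff_map_eq_zero]
    intro t ht
    obtain ⟨t, rfl⟩ := hrC t
    have h1 : dualTensorHom R P₀ C t ∘ₗ f = 0 := by
      rw [← LinearMap.comp_apply, hΦ] at ht
      exact ht
    obtain ⟨ψ, hψ⟩ := LinearMap.exists_eq_comp_of_surjective_of_ker_le hg
      (φ := dualTensorHom R P₀ C t)
      (by rw [← hfg]; exact LinearMap.range_le_ker_iff.2 h1)
    obtain ⟨t', rfl⟩ := hX ψ
    have h2 : t = g.dualMap.rTensor C t' := dualTensorHom_bijective.1 <|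
      hψ.trans (LinearMap.congr_fun (dualTensorHom_comp_rTensor_dualMap g) t').symm
    have h3 : r ∘ₗ g.dualMap = 0 := by
      ext χ
      refine hj ?_
      rw [LinearMap.comp_apply, ← LinearMap.comp_apply, hjr, LinearMap.zero_apply, map_zero]
      ext p
      have : g (f p) = 0 := LinearMap.mem_ker.1 (hfg ▸ LinearMap.mem_range_self f p)
      simp [this]
    rw [h2, ← LinearMap.rTensor_comp_apply, h3, LinearMap.rTensor_zero, LinearMap.zero_apply]
  have hrange : LinearMap.range Φ = LinearMap.range (f.lcomp R C) := by
    rw [← LinearMap.range_comp_of_range_eq_top Φ (LinearMap.range_eq_top.2 hrC), hΦ,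
      LinearMap.range_comp_of_range_eq_top _ (LinearMap.range_eq_top.2 dualTensorHom_bijective.2)]
  exact ⟨LinearEquiv.ofInjective Φ hinj ≪≫ₗ LinearEquiv.ofEq _ _ hrange⟩

open TensorProduct in
/-- If `P₁ → P₀ → X → 0` is exact with `P₀` finite projective and `X` torsionless, `P₀* → L` has
kernel `X*`, covered by `Q`, and every map `L → C` comes from `L* ⊗ C`, then `X ⊗ C` is the image
of `Hom(P₀*, C) → Hom(Q, C)`. -/
lemma exists_tensor_equiv_range_lcomp {R C P₀ P₁ X L Q : Type*} [CommRing R]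
    [AddCommGroup C] [Module R C]
    [AddCommGroup P₀] [Module R P₀] [Module.Finite R P₀] [Module.Projective R P₀]
    [AddCommGroup P₁] [Module R P₁] [AddCommGroup X] [Module R X]
    [AddCommGroup L] [Module R L] [AddCommGroup Q] [Module R Q]
    {f : P₁ →ₗ[R] P₀} {g : P₀ →ₗ[R] X}
    (hg : Function.Surjective g) (hfg : LinearMap.range f = LinearMap.ker g)
    (hX : ∀ x : X, (∀ χ : Module.Dual R X, χ x = 0) → x = 0)
    {h : Module.Dual R P₀ →ₗ[R] L} (hh : Function.Surjective h)
    (hker : LinearMap.ker h = LinearMap.ker f.dualMap)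
    {k : Q →ₗ[R] Module.Dual R P₀} (hk : LinearMap.range k = LinearMap.ker h)
    (hL : Function.Surjective (dualTensorHom R L C)) :
    Nonempty (X ⊗[R] C ≃ₗ[R] LinearMap.range (k.lcomp R C)) := by
  let η := Module.evalEquiv R P₀
  let d := dualTensorHom R (Module.Dual R P₀) C
  let b := (k.lcomp R C).rangeRestrict ∘ₗ d ∘ₗ η.toLinearMap.rTensor C
  have hb : Function.Surjective b :=
    (k.lcomp R C).surjective_rangeRestrict.comp <| dualTensorHom_bijective.2.comp <|
      LinearMap.rTensor_surjective C η.surjective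
  have ha : Function.Surjective (g.rTensor C) := LinearMap.rTensor_surjective C hg
  have hb0 (t) : b t = 0 ↔ d (η.toLinearMap.rTensor C t) ∘ₗ k = 0 := Subtype.ext_iff
  have key : LinearMap.ker (g.rTensor C) = LinearMap.ker b := by
    ext t
    rw [LinearMap.mem_ker, LinearMap.mem_ker, hb0]
    constructor
    · intro ht
      obtain ⟨u, rfl⟩ := (rTensor_exact C (LinearMap.exact_iff.2 hfg.symm) hg t).1 ht
      have h0 : k.dualMap ∘ₗ η.toLinearMap ∘ₗ f = 0 := by
        ext p q
        have : k q ∈ LinearMap.ker f.dualMap := hker ▸ hk ▸ LinearMap.mem_range_self k q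
        exact LinearMap.congr_fun (LinearMap.mem_ker.1 this) p
      have h1 := LinearMap.congr_fun (dualTensorHom_comp_rTensor_dualMap (P := C) k)
        (η.toLinearMap.rTensor C (f.rTensor C u))
      rw [LinearMap.comp_apply, ← LinearMap.rTensor_comp_apply, ← LinearMap.rTensor_comp_apply,
        LinearMap.comp_assoc, h0, LinearMap.rTensor_zero, LinearMap.zero_apply, map_zero] at h1
      exact h1.symm
    · intro ht
      obtain ⟨ψ, hψ⟩ := LinearMap.exists_eq_comp_of_surjective_of_ker_le hh
        (φ := d (η.toLinearMap.rTensor C t)) (by rw [← hk]; exact LinearMap.range_le_ker_iff.2 ht)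
      obtain ⟨u, rfl⟩ := hL ψ
      have h1 : η.toLinearMap.rTensor C t = h.dualMap.rTensor C u := dualTensorHom_bijective.1 <|
        hψ.trans (LinearMap.congr_fun (dualTensorHom_comp_rTensor_dualMap h) u).symm
      have h2 : t = (η.symm.toLinearMap ∘ₗ h.dualMap).rTensor C u := by
        rw [LinearMap.rTensor_comp_apply, ← h1, ← LinearMap.rTensor_comp_apply]
        simp
      have h3 : g ∘ₗ η.symm.toLinearMap ∘ₗ h.dualMap = 0 := by
        ext l
        refine hX _ fun χ => ?_
        have h4 : η (η.symm (h.dualMap l)) (χ ∘ₗ g) = 0 := by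
          rw [LinearEquiv.apply_symm_apply, LinearMap.dualMap_apply]
          have : χ ∘ₗ g ∈ LinearMap.ker h := by
            rw [hker, LinearMap.mem_ker]
            ext p
            have : g (f p) = 0 := LinearMap.mem_ker.1 (hfg ▸ LinearMap.mem_range_self f p)
            simp [this]
          rw [LinearMap.mem_ker.1 this, map_zero]
        exact h4
      rw [h2, ← LinearMap.rTensor_comp_apply, h3, LinearMap.rTensor_zero, LinearMap.zero_apply]
  exact ⟨((g.rTensor C).quotKerEquivOfSurjective ha).symm ≪≫ₗ Submodule.quotEquivOfEq _ _ key ≪≫ₗ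
    b.quotKerEquivOfSurjective hb⟩

open Paper in
/-- Lemma 3.4: sufficient conditions for `M` to be horizontally
linked with respect to a semidualizing module `C`. -/
theorem stmt_0 (R : Type u) [CommRing R] [IsNoetherianRing R]
    (hsemiperf : IsSemiperfectRing R)
    (C : Type u) [AddCommGroup C] [Module R C] (hC : IsSemidualizing R C)
    (M : Type u) [AddCommGroup M] [Module R M] [Module.Finite R M]
    -- (i) `M` is `C`-stable and a `C`-syzygy
    (h1a : IsCStable R C M) (h1b : IsCSyzygy R C M)
    -- (ii) first part: `underline-Hom_R(Hom_R(C,M), C) = 0`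
    (h2a : StableHomZero R (C →ₗ[R] M) C)
    -- (iii) first part: the natural evaluation map `C ⊗_R Hom_R(C,M) → M` is an isomorphism
    (h3a : Function.Bijective (evalMap R C M))
    -- (ii) second part and (iii) second part, for `λ(Hom_R(C,M)) = Ω Tr Hom_R(C,M)`:
    -- `underline-Hom_R(λ(Hom_R(C,M)), C) = 0` and the natural map
    -- `λ(Hom_R(C,M)) → Hom_R(C, λ(Hom_R(C,M)) ⊗_R C)` is an isomorphism
    (h23b : ∃ L : ModuleCat.{u} R, IsOmegaTrC R R (C →ₗ[R] M) L ∧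
      StableHomZero R L C ∧
      Function.Bijective (TensorProduct.mk R (L : Type u) C)) :
    IsHorizontallyLinked R C M := by
  obtain ⟨L, ⟨pres, ⟨e⟩⟩, hLC, hL⟩ := h23b
  have := pres.finite₀
  have := pres.finite₁
  have := pres.proj₀
  have := pres.proj₁
  have : Module.Finite R (C →ₗ[R] M) := .of_surjective pres.g pres.surj
  let h : Module.Dual R pres.P₀ →ₗ[R] L := e.symm.toLinearMap ∘ₗ pres.f.dualMap.rangeRestrict
  have hh : Function.Surjective h :=
    e.symm.surjective.comp pres.f.dualMap.surjective_rangeRestrict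
  have hker : LinearMap.ker h = LinearMap.ker pres.f.dualMap := by
    exact (LinearEquiv.ker_comp _ _).trans (LinearMap.ker_rangeRestrict _)
  have : Module.Finite R L := .of_surjective h hh
  let N := LinearMap.range (pres.homC C)
  obtain ⟨ε⟩ := exists_tensor_equiv_range_lcomp_of_dualMap_eq (C := C) pres.surj pres.exact
    h2a.dualTensorHom_surjective hh (j := (LinearMap.range (pres.homC R)).subtype ∘ₗ e.toLinearMap)
    (Subtype.val_injective.comp e.injective)
    (LinearMap.ext fun φ => congrArg Subtype.val (e.apply_symm_apply _))
  let Λ : L ≃ₗ[R] (C →ₗ[R] N) := LinearEquiv.ofBijective _ hL ≪≫ₗ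
    LinearEquiv.congrRight ε
  have hsmall : LinearMap.ker h ≤
      Ideal.jacobson (⊥ : Ideal R) • (⊤ : Submodule R (Module.Dual R pres.P₀)) := by
    obtain ⟨n, a, m, hm, hsum, hidem, hone, -, hjac, hinv⟩ :=
      exists_idempotents_of_isSemiperfectRing hsemiperf
    intro φ hφ
    rw [hker] at hφ
    obtain ⟨χ, rfl⟩ := LinearMap.exists_eq_comp_of_surjective_of_ker_le pres.surj
      (φ := φ) (pres.exact ▸ LinearMap.range_le_ker_iff.2 hφ)
    refine Module.Dual.mem_ideal_smul_top fun p => ?_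
    rw [← mul_one ((χ ∘ₗ pres.g) p), ← hsum, Finset.mul_sum]
    refine sum_mem fun i _ => hjac i _ ?_
    by_contra hp
    obtain ⟨s, hs⟩ := hinv i _ hp
    have h0 : a i = 0 := h1a.eq_zero_of_idempotent hC.2.1.1 h3a χ (pres.g p) (hidem i) hs
    have := hone i
    rw [h0, sub_zero] at this
    exact (hm i).ne_top ((Ideal.eq_top_iff_one _).2 this)
  obtain ⟨Q, _, _, π, hQ, hQ', hπ, hmin⟩ := exists_projective_cover hsemiperf (LinearMap.ker h)
  let k : Q →ₗ[R] Module.Dual R pres.P₀ := (LinearMap.ker h).subtype ∘ₗ π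
  have hk : LinearMap.range k = LinearMap.ker h := by
    rw [LinearMap.range_comp_of_range_eq_top _ (LinearMap.range_eq_top.2 hπ),
      Submodule.range_subtype]
  have hkerΛ : LinearMap.ker (Λ.toLinearMap ∘ₗ h) = LinearMap.ker h := LinearEquiv.ker_comp _ _
  let pres' : MinPres R (C →ₗ[R] N) :=
    { P₁ := Q
      P₀ := Module.Dual R pres.P₀
      f := k
      g := Λ.toLinearMap ∘ₗ h
      finite₁ := hQ
      finite₀ := inferInstance
      proj₁ := hQ'
      proj₀ := inferInstance
      surj := Λ.surjective.comp hh
      exact := hk.trans hkerΛ.symm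
      min₀ := fun _ hN => eq_top_of_sup_eq_top_of_le_jacobson_smul (hkerΛ.trans_le hsmall) hN
      min₁ := fun N' hN => hmin N' <| by
        rwa [LinearMap.ker_comp_of_ker_eq_bot _ (Submodule.ker_subtype _)] at hN }
  obtain ⟨ζ⟩ := exists_tensor_equiv_range_lcomp (C := C) pres.surj pres.exact
    (h1b.eq_zero_of_forall_dual hC.2.1) hh hker hk hLC.dualTensorHom_surjective
  exact ⟨ModuleCat.of R N, ⟨pres, ⟨LinearEquiv.refl R N⟩⟩, pres',
    ⟨(LinearEquiv.ofBijective _ h3a).symm ≪≫ₗ TensorProduct.comm R _ _ ≪≫ₗ ζ⟩⟩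
end
end

section
/- Let R be a commutative Noetherian ring, C a semidualizing R-module, M a finitely generated R-module, and μ: M → Hom_R(C, M ⊗_R C) the natural map. (i) If M satisfies (S̃_1) and the localization μ_p is a monomorphism for every p ∈ X^0(R), then μ is a monomorphism. (ii) If M satisfies (S̃_2), M ⊗_R C satisfies (S̃_1), and μ_p is an isomorphism for every p ∈ X^1(R), then μ is an isomorphism. -/
/- Preliminary definitions for formalizing
   "Linkage of modules with respect to a semidualizing module"
   (Dibaei–Sadeghi). -/

open CategoryTheory

universe u
noncomputable section
namespace Paper

section ExtLemmas

variable {A : Type u} [CommRing A]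

/-- A cocycle `φ : P₀ → N` of degree `0` vanishes when `Ext⁰` does. -/
lemma eq_zero_of_subsingleton_extGrp_zero {X N : Type u} [AddCommGroup X] [Module A X]
    [AddCommGroup N] [Module A N] (P : ProjectiveResolution (ModuleCat.of A X))
    (h : Subsingleton (ExtGrp A X N 0)) (φ : P.complex.X 0 →ₗ[A] N)
    (hφ : φ ∘ₗ (P.complex.d 1 0).hom = 0) : φ = 0 := by
  have hz := (ModuleCat.isZero_of_subsingleton (((Ext A (ModuleCat.{u} A) 0).obj
    (Opposite.op (ModuleCat.of A X))).obj (ModuleCat.of A N))).of_iso (P.isoExt (R := A) 0 _).symm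
  rw [← HomologicalComplex.exactAt_iff_isZero_homology,
    HomologicalComplex.exactAt_iff' _ 0 0 1 (by simp) (by simp),
    ShortComplex.moduleCat_exact_iff] at hz
  obtain ⟨ψ, hψ⟩ := hz (ModuleCat.ofHom φ) (ModuleCat.hom_ext hφ)
  have h0 : (P.complex.linearYonedaObj A (ModuleCat.of A N)).d 0 0 = 0 :=
    HomologicalComplex.shape _ _ _ (by simp)
  have h1 : (P.complex.linearYonedaObj A (ModuleCat.of A N)).d 0 0 ψ = ModuleCat.ofHom φ := hψ
  rw [h0] at h1
  exact (congrArg ModuleCat.Hom.hom h1).symm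

/-- A cocycle `φ : P₁ → N` of degree `1` is a coboundary when `Ext¹` vanishes. -/
lemma exists_comp_eq_of_subsingleton_extGrp_one {X N : Type u} [AddCommGroup X] [Module A X]
    [AddCommGroup N] [Module A N] (P : ProjectiveResolution (ModuleCat.of A X))
    (h : Subsingleton (ExtGrp A X N 1)) (φ : P.complex.X 1 →ₗ[A] N)
    (hφ : φ ∘ₗ (P.complex.d 2 1).hom = 0) :
    ∃ ψ : P.complex.X 0 →ₗ[A] N, ψ ∘ₗ (P.complex.d 1 0).hom = φ := by
  have hz := (ModuleCat.isZero_of_subsingleton (((Ext A (ModuleCat.{u} A) 1).obj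
    (Opposite.op (ModuleCat.of A X))).obj (ModuleCat.of A N))).of_iso (P.isoExt (R := A) 1 _).symm
  rw [← HomologicalComplex.exactAt_iff_isZero_homology,
    HomologicalComplex.exactAt_iff' _ 0 1 2 (by simp) (by simp),
    ShortComplex.moduleCat_exact_iff] at hz
  obtain ⟨ψ, hψ⟩ := hz (ModuleCat.ofHom φ) (ModuleCat.hom_ext hφ)
  exact ⟨ModuleCat.Hom.hom ψ, congrArg ModuleCat.Hom.hom hψ⟩

lemma exists_exact_surjective {X : Type u} [AddCommGroup X] [Module A X]
    (P : ProjectiveResolution (ModuleCat.of A X)) :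
    ∃ π : P.complex.X 0 →ₗ[A] X,
      Function.Exact (P.complex.d 1 0).hom π ∧ Function.Surjective π :=
  ⟨(P.π.f 0).hom, (ShortComplex.ShortExact.moduleCat_exact_iff_function_exact _).mp P.exact₀,
    (ModuleCat.epi_iff_surjective (P.π.f 0)).mp inferInstance⟩

lemma nontrivial_extGrp_zero {N : Type u} [AddCommGroup N] [Module A N] {I : Ideal A} {z : N}
    (hz : z ≠ 0) (hI : ∀ x ∈ I, x • z = 0) : Nontrivial (ExtGrp A (A ⧸ I) N 0) := by
  by_contra h
  rw [not_nontrivial_iff_subsingleton] at h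
  obtain ⟨P⟩ : Nonempty (ProjectiveResolution (ModuleCat.of A (A ⧸ I))) :=
    ⟨ProjectiveResolution.of _⟩
  obtain ⟨π, hex, hsurj⟩ := exists_exact_surjective P
  let f : (A ⧸ I) →ₗ[A] N :=
    Submodule.liftQ I (LinearMap.toSpanSingleton A N z) fun x hx ↦ hI x hx
  have h0 : f ∘ₗ π = 0 := eq_zero_of_subsingleton_extGrp_zero P h _ (by
    rw [LinearMap.comp_assoc, hex.linearMap_comp_eq_zero, LinearMap.comp_zero])
  obtain ⟨p, hp⟩ := hsurj (Submodule.Quotient.mk 1)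
  apply hz
  have hzp : z = f (π p) := by
    rw [hp]
    exact (one_smul A z).symm
  rw [hzp]
  exact LinearMap.congr_fun h0 p

lemma exists_forall_eq_smul_of_subsingleton_extGrp_one {N : Type u} [AddCommGroup N] [Module A N]
    {I : Ideal A} (h : Subsingleton (ExtGrp A (A ⧸ I) N 1)) (g : I →ₗ[A] N) :
    ∃ y : N, ∀ x : I, g x = (x : A) • y := by
  obtain ⟨P⟩ : Nonempty (ProjectiveResolution (ModuleCat.of A (A ⧸ I))) :=
    ⟨ProjectiveResolution.of _⟩
  obtain ⟨π, hex, hsurj⟩ := exists_exact_surjective P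
  have hproj : Module.Projective A (P.complex.X 0) :=
    (IsProjective.iff_projective _).mpr (P.projective 0)
  obtain ⟨φ, hφ⟩ := Module.projective_lifting_property (Submodule.mkQ I) π
    (Submodule.mkQ_surjective I)
  have hφπ (p) : Submodule.Quotient.mk (φ p) = π p := LinearMap.congr_fun hφ p
  have hmem (q : P.complex.X 1) : φ ((P.complex.d 1 0).hom q) ∈ I := by
    rw [← Submodule.Quotient.mk_eq_zero, hφπ, hex.apply_apply_eq_zero]
  obtain ⟨ψ, hψ⟩ := exists_comp_eq_of_subsingleton_extGrp_one P h
    (g ∘ₗ (φ ∘ₗ (P.complex.d 1 0).hom).codRestrict I hmem) (by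
      ext q
      have hd : (P.complex.d 1 0).hom ((P.complex.d 2 1).hom q) = 0 :=
        LinearMap.congr_fun (congrArg ModuleCat.Hom.hom (P.complex.d_comp_d 2 1 0)) q
      have : (φ ∘ₗ (P.complex.d 1 0).hom).codRestrict I hmem ((P.complex.d 2 1).hom q) = 0 :=
        Subtype.ext (by simp [hd])
      simp [this])
  obtain ⟨p, hp⟩ := hsurj (Submodule.Quotient.mk 1)
  have hp1 : φ p - 1 ∈ I := by
    rw [← Submodule.Quotient.mk_eq_zero, Submodule.Quotient.mk_sub, hφπ, hp, sub_self]
  refine ⟨ψ p - g ⟨φ p - 1, hp1⟩, fun x ↦ ?_⟩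
  obtain ⟨q, hq⟩ : ∃ q, (P.complex.d 1 0).hom q = (x : A) • p := by
    refine (hex _).mp ?_
    rw [map_smul, hp, ← Submodule.Quotient.mk_smul, Submodule.Quotient.mk_eq_zero]
    simp
  have hψp : (x : A) • ψ p = g ⟨(x : A) * φ p, I.mul_mem_right _ x.2⟩ := by
    rw [← map_smul, ← hq]
    refine (LinearMap.congr_fun hψ q).trans (congrArg g (Subtype.ext ?_))
    simp [hq]
  rw [smul_sub, hψp, ← map_smul, ← map_sub]
  exact congrArg g (Subtype.ext (by simp [mul_sub]))

end ExtLemmas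

section Depth

variable {R : Type u} [CommRing R]

lemma edepth_le {I : Ideal R} {N : Type u} [AddCommGroup N] [Module R N] {i : ℕ}
    (h : Nontrivial (ExtGrp R (R ⧸ I) N i)) : edepth R I N ≤ i :=
  sInf_le ⟨i, rfl, h⟩

variable [IsNoetherianRing R]

lemma depthAt_eq_zero_of_mem_associatedPrimes {N : Type u} [AddCommGroup N] [Module R N]
    {p : Ideal R} [p.IsPrime] (h : p ∈ associatedPrimes R N) : depthAt R p N = 0 := by
  obtain ⟨-, z, hz⟩ := (isAssociatedPrime_iff ..).mp
    (Module.associatedPrimes.mem_associatedPrimes_atPrime_of_mem_associatedPrimes h)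
  refine nonpos_iff_eq_zero.mp (edepth_le (i := 0) (nontrivial_extGrp_zero (z := z) ?_ ?_))
  · rintro rfl
    exact (IsLocalRing.maximalIdeal.isMaximal _).ne_top
      (hz.trans (by ext; simp [Submodule.mem_colon_singleton]))
  · intro x hx
    rw [hz] at hx
    simpa [Submodule.mem_colon_singleton] using hx

/-- `Ass (Hom(C, N)) ⊆ Ass N` for finite `C`. -/
lemma associatedPrimes_hom_subset {C N : Type u} [AddCommGroup C] [Module R C]
    [Module.Finite R C] [AddCommGroup N] [Module R N] :
    associatedPrimes R (C →ₗ[R] N) ⊆ associatedPrimes R N := by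
  intro p hp
  obtain ⟨hprime, f, hf⟩ := (isAssociatedPrime_iff ..).mp hp
  obtain ⟨s, hs⟩ := Module.Finite.fg_top (R := R) (M := C)
  have hle : s.inf (fun c ↦ (⊥ : Submodule R N).colon {f c}) ≤ p := by
    intro r hr
    rw [hf, Submodule.mem_colon_singleton, Submodule.mem_bot]
    refine LinearMap.ext_on hs fun c hc ↦ ?_
    have := (Submodule.mem_finsetInf.mp hr) c hc
    simpa [Submodule.mem_colon_singleton] using this
  obtain ⟨c, -, hc⟩ := hprime.inf_le'.mp hle
  refine (isAssociatedPrime_iff ..).mpr ⟨hprime, f c, le_antisymm (fun r hr ↦ ?_) hc⟩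
  rw [hf, Submodule.mem_colon_singleton, Submodule.mem_bot] at hr
  simpa [Submodule.mem_colon_singleton] using LinearMap.congr_fun hr c

lemma mem_associatedPrimes_of_localizedModule {N : Type u} [AddCommGroup N] [Module R N]
    {p : Ideal R} [p.IsPrime] {z : LocalizedModule p.primeCompl N} (hz : z ≠ 0)
    (h : ∀ x ∈ IsLocalRing.maximalIdeal (Localization.AtPrime p), x • z = 0) :
    p ∈ associatedPrimes R N := by
  have hass : IsLocalRing.maximalIdeal (Localization.AtPrime p) ∈
      associatedPrimes (Localization.AtPrime p) (LocalizedModule p.primeCompl N) := by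
    refine (isAssociatedPrime_iff ..).mpr ⟨inferInstance, z, ?_⟩
    refine (IsLocalRing.maximalIdeal.isMaximal _).eq_of_le (fun ht ↦ hz ?_) fun x hx ↦ ?_
    · have := (Ideal.eq_top_iff_one _).mp ht
      simpa [Submodule.mem_colon_singleton] using this
    · simpa [Submodule.mem_colon_singleton] using h x hx
  open Module.associatedPrimes in
  have := comap_mem_associatedPrimes_of_mem_associatedPrimes_of_isLocalizedModule_of_fg
    p.primeCompl (LocalizedModule.mkLinearMap p.primeCompl N) _ hass (IsNoetherian.noetherian _)
  rwa [← Ideal.under_def, Localization.AtPrime.under_maximalIdeal] at this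

lemma injective_of_localized_of_serreTilde_one {M H : Type u} [AddCommGroup M] [Module R M]
    [AddCommGroup H] [Module R H] (f : M →ₗ[R] H) (hM : SerreTilde R 1 M)
    (h : ∀ (p : Ideal R) (_ : p.IsPrime), ringDepthAt R p = 0 →
      Function.Injective (LocalizedModule.map p.primeCompl f)) : Function.Injective f := by
  rw [← LinearMap.ker_eq_bot]
  by_contra hK
  have := Submodule.nontrivial_iff_ne_bot.mpr hK
  obtain ⟨p, hp⟩ := associatedPrimes.nonempty R f.ker
  have hprime : p.IsPrime := hp.isPrime
  have hdepth := hM p hprime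
  rw [depthAt_eq_zero_of_mem_associatedPrimes
    (associatedPrimes.subset_of_injective f.ker.subtype_injective hp)] at hdepth
  have h0 : ringDepthAt R p = 0 := by simpa using hdepth
  obtain ⟨-, ⟨z, hz⟩, hpz⟩ := (isAssociatedPrime_iff ..).mp hp
  have hz0 : LocalizedModule.mk z (1 : p.primeCompl) = 0 := h p hprime h0 (by
    rw [map_zero, LocalizedModule.map_mk, LinearMap.mem_ker.mp hz, LocalizedModule.zero_mk])
  obtain ⟨s, hs⟩ := (IsLocalizedModule.eq_zero_iff p.primeCompl
    (LocalizedModule.mkLinearMap p.primeCompl M)).mp hz0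
  refine s.2 (hpz.ge ?_)
  rw [Submodule.mem_colon_singleton, Submodule.mem_bot]
  exact Subtype.ext hs

lemma surjective_of_localized_of_serreTilde_two {M H : Type u} [AddCommGroup M] [Module R M]
    [AddCommGroup H] [Module R H] (f : M →ₗ[R] H) (hf : Function.Injective f)
    (hM : SerreTilde R 2 M)
    (hH : ∀ (p : Ideal R) (_ : p.IsPrime), ringDepthAt R p ≠ 0 → p ∉ associatedPrimes R H)
    (h : ∀ (p : Ideal R) (_ : p.IsPrime), ringDepthAt R p ≤ 1 →
      Function.Surjective (LocalizedModule.map p.primeCompl f)) : Function.Surjective f := by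
  rw [← LinearMap.range_eq_top]
  by_contra hD
  have := Submodule.Quotient.nontrivial_iff.mpr hD
  obtain ⟨p, hp⟩ := associatedPrimes.nonempty R (H ⧸ f.range)
  have hprime : p.IsPrime := hp.isPrime
  obtain ⟨-, d, hpd⟩ := (isAssociatedPrime_iff ..).mp hp
  obtain ⟨e, rfl⟩ := Submodule.mkQ_surjective _ d
  have hmem (r : R) : r ∈ p ↔ r • e ∈ f.range := by
    rw [hpd, Submodule.mem_colon_singleton, Submodule.mem_bot, ← map_smul, ← LinearMap.mem_ker,
      Submodule.ker_mkQ]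
  let F := LocalizedModule.map p.primeCompl f
  let E : LocalizedModule p.primeCompl H := LocalizedModule.mk e 1
  have hE : E ∉ F.range := by
    rintro ⟨w, hw⟩
    induction w using LocalizedModule.induction_on with | _ m s
    rw [LocalizedModule.map_mk, LocalizedModule.mk_eq] at hw
    obtain ⟨t, ht⟩ := hw
    refine (t * s).2 ((hmem _).mpr ⟨(t : R) • m, ?_⟩)
    rw [map_smul, Submonoid.coe_mul, mul_smul]
    simpa [Submonoid.smul_def] using ht
  have hdepth : ¬ ringDepthAt R p ≤ 1 := fun hle ↦ hE (h p hprime hle E)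
  have h0 : ringDepthAt R p ≠ 0 := fun h0 ↦ hdepth (by simp [h0])
  have hExt : Subsingleton (ExtGrp (Localization.AtPrime p)
      (Localization.AtPrime p ⧸ IsLocalRing.maximalIdeal (Localization.AtPrime p))
      (LocalizedModule p.primeCompl M) 1) := by
    rw [← not_nontrivial_iff_subsingleton]
    intro hnt
    have hle : min (2 : ℕ∞) (ringDepthAt R p) ≤ 1 := (hM p hprime).trans (edepth_le hnt)
    rcases min_le_iff.mp hle with h2 | h1
    · exact absurd h2 (by decide)
    · exact hdepth h1
  have hF : Function.Injective F := IsLocalizedModule.map_injective p.primeCompl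
    (LocalizedModule.mkLinearMap p.primeCompl M) (LocalizedModule.mkLinearMap p.primeCompl H) f hf
  have hIE : IsLocalRing.maximalIdeal (Localization.AtPrime p) ≤
      F.range.comap (LinearMap.toSpanSingleton _ _ E) := by
    rw [← Localization.AtPrime.map_eq_maximalIdeal, Ideal.map_le_iff_le_comap]
    intro r hr
    obtain ⟨m, hm⟩ := (hmem r).mp hr
    refine ⟨LocalizedModule.mk m 1, ?_⟩
    rw [LocalizedModule.map_mk, hm, ← LocalizedModule.smul'_mk]
    exact (algebraMap_smul _ r E).symm
  let eqv := LinearEquiv.ofInjective F hF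
  obtain ⟨y, hy⟩ := exists_forall_eq_smul_of_subsingleton_extGrp_one hExt
    (eqv.symm.toLinearMap ∘ₗ (LinearMap.toSpanSingleton _ _ E).restrict hIE)
  refine hH p hprime h0 (mem_associatedPrimes_of_localizedModule (z := E - F y) ?_ ?_)
  · intro hz
    exact hE ⟨y, (sub_eq_zero.mp hz).symm⟩
  · intro x hx
    have := congrArg (fun z ↦ (eqv z : LocalizedModule p.primeCompl H)) (hy ⟨x, hx⟩)
    rw [smul_sub, sub_eq_zero, ← map_smul]
    simpa [eqv] using this

end Depth
end Paper

open Paper in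
/-- Lemma 3.5: on the natural map `μ : M → Hom_R(C, M ⊗_R C)`. -/
theorem stmt_1 (R : Type u) [CommRing R] [IsNoetherianRing R]
    (C : Type u) [AddCommGroup C] [Module R C] (hC : IsSemidualizing R C)
    (M : Type u) [AddCommGroup M] [Module R M] [Module.Finite R M] :
    -- (i)
    (SerreTilde R 1 M →
      (∀ (p : Ideal R) (_ : p.IsPrime), ringDepthAt R p = 0 →
        Function.Injective (LocalizedModule.map p.primeCompl (TensorProduct.mk R M C))) →
      Function.Injective (TensorProduct.mk R M C)) ∧
    -- (ii)
    (SerreTilde R 2 M → SerreTilde R 1 (TensorProduct R M C) →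
      (∀ (p : Ideal R) (_ : p.IsPrime), ringDepthAt R p ≤ 1 →
        Function.Bijective (LocalizedModule.map p.primeCompl (TensorProduct.mk R M C))) →
      Function.Bijective (TensorProduct.mk R M C)) := by
  have := hC.1
  refine ⟨fun hM h ↦ injective_of_localized_of_serreTilde_one _ hM h, fun hM hMC h ↦ ?_⟩
  have hM1 : SerreTilde R 1 M := fun p hp ↦
    (min_le_min_right _ (by norm_num)).trans (hM p hp)
  have hinj := injective_of_localized_of_serreTilde_one (TensorProduct.mk R M C) hM1
    fun p hp h0 ↦ (h p hp (by simp [h0])).1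
  refine ⟨hinj, surjective_of_localized_of_serreTilde_two _ hinj hM ?_ fun p hp h1 ↦ (h p hp h1).2⟩
  intro p hp h0 hass
  have hdepth := hMC p hp
  rw [depthAt_eq_zero_of_mem_associatedPrimes (associatedPrimes_hom_subset hass)] at hdepth
  exact h0 (by simpa using hdepth)
end
end

section
/- Let R be a commutative Noetherian local ring, C a semidualizing R-module, n ≥ 0 an integer, and M a finitely generated R-module lying in the Bass class B_C. Then: (i) depth_R(M) = depth_R(Hom_R(C,M)) and dim_R(M) = dim_R(Hom_R(C,M)); (ii) M satisfies (S̃_n) if and only if Hom_R(C,M) satisfies (S̃_n); (iii) M is a Cohen-Macaulay R-module if and only if Hom_R(C,M) is a Cohen-Macaulay R-module. -/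
/- Preliminary definitions for formalizing
   "Linkage of modules with respect to a semidualizing module"
   (Dibaei–Sadeghi). -/

open CategoryTheory

universe u
noncomputable section
theorem subsingleton_leftDerivedExt_iff {R : Type u} [CommRing R] (X Y : ModuleCat.{u} R) (n : ℕ) :
    Subsingleton (((Ext R (ModuleCat.{u} R) n).obj (Opposite.op X)).obj Y) ↔
      Subsingleton (Abelian.Ext X Y n) := by
  let P := ProjectiveResolution.of X
  rw [← ModuleCat.isZero_iff_subsingleton, (P.isoExt n Y).isZero_iff,
    ← HomologicalComplex.exactAt_iff_isZero_homology]
  cases n with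
  | zero =>
    rw [HomologicalComplex.exactAt_iff' _ 0 0 1 (by simp) (by simp),
      ShortComplex.moduleCat_exact_iff, Abelian.Ext.addEquiv₀.subsingleton_congr]
    constructor
    · intro h
      refine subsingleton_of_forall_eq 0 fun f ↦ ?_
      let π : P.complex.X 0 ⟶ X := P.π.f 0
      have hπ : P.complex.d 1 0 ≫ π = 0 := P.complex_d_comp_π_f_zero
      have : Epi π := inferInstanceAs (Epi (P.π.f 0))
      obtain ⟨g, hg⟩ : ∃ g : P.complex.X 0 ⟶ Y, P.complex.d 0 0 ≫ g = π ≫ f :=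
        h (π ≫ f) (by
          change P.complex.d 1 0 ≫ π ≫ f = 0
          rw [← Category.assoc, hπ, Limits.zero_comp])
      rw [P.complex.shape 0 0 (by simp), Limits.zero_comp] at hg
      exact (cancel_epi π).mp (by rw [← hg, Limits.comp_zero])
    · intro h φ hφ
      have hφ' : P.complex.d 1 0 ≫ φ = 0 := hφ
      refine ⟨(0 : P.complex.X 0 ⟶ Y), (Limits.comp_zero : P.complex.d 0 0 ≫ 0 = 0).trans ?_⟩
      have := P.isColimitCokernelCofork.fac (Limits.CokernelCofork.ofπ φ hφ')
        Limits.WalkingParallelPair.one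
      rw [show P.isColimitCokernelCofork.desc (Limits.CokernelCofork.ofπ φ hφ') = 0 from
        h.elim _ _, Limits.comp_zero] at this
      exact this
  | succ n =>
    rw [HomologicalComplex.exactAt_iff' _ n (n + 1) (n + 2) (by simp) (by simp),
      ShortComplex.moduleCat_exact_iff]
    constructor
    · intro h
      refine subsingleton_of_forall_eq 0 fun α ↦ ?_
      obtain ⟨f, hf, rfl⟩ := P.extMk_surjective α (n + 2) rfl
      rw [P.extMk_eq_zero_iff _ _ _ _ n rfl]
      exact h f hf
    · intro h f hf
      exact (P.extMk_eq_zero_iff f (n + 2) rfl hf n rfl).mp (Subsingleton.elim _ _)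

section

open Pointwise

theorem subsingleton_ext_congr {R : Type u} [CommRing R] (X : ModuleCat.{u} R)
    {Y Y' : ModuleCat.{u} R} (e : Y ≅ Y') (n : ℕ) :
    Subsingleton (Abelian.Ext X Y n) ↔ Subsingleton (Abelian.Ext X Y' n) :=
  ((Abelian.extFunctorObj X n).mapIso e).addCommGroupIsoToAddEquiv.subsingleton_congr

theorem subsingleton_ext_zero_iff {R : Type u} [CommRing R] (N M : ModuleCat.{u} R) :
    Subsingleton (Abelian.Ext N M 0) ↔ Subsingleton (N →ₗ[R] M) :=
  (Abelian.Ext.addEquiv₀.trans ModuleCat.homAddEquiv).subsingleton_congr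

theorem forall_lt_succ_subsingleton_ext_iff {R : Type u} [CommRing R] (N M : ModuleCat.{u} R)
    {x : R} (hN : x ∈ Module.annihilator R N) (hM : IsSMulRegular M x) (n : ℕ) :
    (∀ i < n + 1, Subsingleton (Abelian.Ext N M i)) ↔
      ∀ i < n, Subsingleton (Abelian.Ext N (ModuleCat.of R (QuotSMulTop x M)) i) := by
  constructor
  · intro h i hi
    have zero₁ := AddCommGrpCat.isZero_of_iff_subsingleton.mpr (h i (by omega))
    have zero₂ := AddCommGrpCat.isZero_of_iff_subsingleton.mpr (h (i + 1) (by omega))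
    exact AddCommGrpCat.subsingleton_of_isZero <| ShortComplex.Exact.isZero_of_both_zeros
      (Abelian.Ext.covariant_sequence_exact₃' N hM.smulShortComplex_shortExact i (i + 1) rfl)
      (zero₁.eq_zero_of_src _) (zero₂.eq_zero_of_tgt _)
  · intro h i hi
    match i with
    | 0 => exact (subsingleton_ext_zero_iff N M).mpr (hM.linearMap_subsingleton_of_mem_annihilator hN)
    | i + 1 =>
      let g := AddCommGrpCat.ofHom
        ((Abelian.Ext.mk₀ (ModuleCat.smulShortComplex M x).f).postcomp N (add_zero (i + 1)))
      have : Mono g :=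
        (Abelian.Ext.covariant_sequence_exact₁' N hM.smulShortComplex_shortExact i (i + 1)
          rfl).mono_g ((AddCommGrpCat.isZero_of_iff_subsingleton.mpr
            (h i (by omega))).eq_zero_of_src _)
      have hg : g = 0 := Abelian.Ext.postcomp_smul_id_eq_zero_of_mem_annihilator hN (i + 1)
      exact AddCommGrpCat.subsingleton_of_isZero (Limits.IsZero.of_mono_eq_zero _ hg)

/-- `HomAcyclic R M n C` says that `C` has the first `n` steps of a resolution by finite free
modules which stays exact under `Hom_R(-, M)` at the first `n` positive degrees. -/
inductive HomAcyclic (R : Type u) [CommRing R] (M : Type u) [AddCommGroup M] [Module R M] :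
    ℕ → ∀ (C : Type u) [AddCommGroup C] [Module R C], Prop
  | zero (C : Type u) [AddCommGroup C] [Module R C] : HomAcyclic R M 0 C
  | succ (n : ℕ) (K F C : Type u) [AddCommGroup K] [Module R K] [AddCommGroup F] [Module R F]
      [AddCommGroup C] [Module R C] [Module.Finite R F] [Module.Free R F]
      (i : K →ₗ[R] F) (p : F →ₗ[R] C) (hi : Function.Injective i) (hp : Function.Surjective p)
      (hip : Function.Exact i p) (hext : ∀ f : K →ₗ[R] M, ∃ g : F →ₗ[R] M, g ∘ₗ i = f)
      (hK : HomAcyclic R M n K) : HomAcyclic R M (n + 1) C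

theorem HomAcyclic.of_subsingleton_ext {R : Type u} [CommRing R] [IsNoetherianRing R]
    (M C : Type u) [AddCommGroup M] [Module R M] [AddCommGroup C] [Module R C] [Module.Finite R C]
    (h : ∀ i : ℕ, 0 < i → Subsingleton (Abelian.Ext (ModuleCat.of R C) (ModuleCat.of R M) i))
    (n : ℕ) : HomAcyclic R M n C := by
  induction n generalizing C with
  | zero => exact .zero C
  | succ n ih =>
    obtain ⟨F, _, _, _, _, p, hp⟩ := Module.exists_finite_presentation R C
    have hS := LinearMap.shortExact_shortComplexKer hp
    refine .succ n (LinearMap.ker p) F C (LinearMap.ker p).subtype p Subtype.val_injective hp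
      (LinearMap.exact_subtype_ker_map p) (fun f ↦ ?_) (ih _ fun i hi ↦ ?_)
    · obtain ⟨y, hy⟩ := Abelian.Ext.contravariant_sequence_exact₁ hS (ModuleCat.of R M)
        (Abelian.Ext.mk₀ (ModuleCat.ofHom f)) (add_zero 1) ((h 1 one_pos).elim _ _)
      obtain ⟨g, rfl⟩ := (Abelian.Ext.mk₀_bijective _ _).2 y
      rw [Abelian.Ext.mk₀_comp_mk₀, (Abelian.Ext.mk₀_bijective _ _).1.eq_iff] at hy
      exact ⟨g.hom, congrArg ModuleCat.Hom.hom hy⟩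
    · refine subsingleton_of_forall_eq 0 fun y ↦ ?_
      have hy : hS.extClass.comp y (add_comm 1 i) = 0 := (h (i + 1) i.succ_pos).elim _ _
      obtain ⟨z, rfl⟩ := Abelian.Ext.contravariant_sequence_exact₁ hS _ y _ hy
      obtain ⟨j, rfl⟩ := Nat.exists_eq_add_one.mpr hi
      rw [(Abelian.Ext.eq_zero_of_projective z : z = 0), Abelian.Ext.comp_zero]

theorem HomAcyclic.localizedModule {R : Type u} [CommRing R] [IsNoetherianRing R] (S : Submonoid R)
    {M C : Type u} [AddCommGroup M] [Module R M] [AddCommGroup C] [Module R C] {n : ℕ}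
    (h : HomAcyclic R M n C) :
    HomAcyclic (Localization S) (LocalizedModule S M) n (LocalizedModule S C) := by
  induction h with
  | zero C => exact .zero _
  | succ n K F C i p hi hp hip hext hK ih =>
    have : Module.Free (Localization S) (LocalizedModule S F) :=
      Module.free_of_isLocalizedModule S (LocalizedModule.mkLinearMap S F)
    have : Module.Finite R K := Module.Finite.of_injective i hi
    have : Module.FinitePresentation R K := Module.finitePresentation_of_finite R K
    refine .succ n _ (LocalizedModule S F) _ (LocalizedModule.map S i) (LocalizedModule.map S p)
      (LocalizedModule.map_injective S i hi) (LocalizedModule.map_surjective S p hp)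
      (LocalizedModule.map_exact S i p hip) (fun f ↦ ?_) ih
    obtain ⟨⟨k, s⟩, hk⟩ := IsLocalizedModule.surj S (LocalizedModule.map S (M := K) (N := M)) f
    obtain ⟨g, rfl⟩ := hext k
    refine ⟨IsLocalization.mk' (Localization S) 1 s • LocalizedModule.map S g, ?_⟩
    have hg : LocalizedModule.map S (g ∘ₗ i) = LocalizedModule.map S g ∘ₗ LocalizedModule.map S i :=
      LinearMap.restrictScalars_injective R <| IsLocalizedModule.map_comp' S
        (LocalizedModule.mkLinearMap S K) (LocalizedModule.mkLinearMap S F)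
        (LocalizedModule.mkLinearMap S M) i g
    have hk' : (s : R) • f = LocalizedModule.map S (g ∘ₗ i) := hk
    rw [LinearMap.smul_comp, ← hg, ← hk', ← algebraMap_smul (Localization S) (s : R) f,
      smul_smul, IsLocalization.mk'_spec, map_one, one_smul]

theorem LinearMap.exists_smul_eq_of_mkQ_comp_eq_zero {R : Type u} [CommRing R]
    {M K : Type u} [AddCommGroup M] [Module R M] [AddCommGroup K] [Module R K]
    {x : R} (hx : IsSMulRegular M x) {f : K →ₗ[R] M}
    (hf : (x • (⊤ : Submodule R M)).mkQ ∘ₗ f = 0) : ∃ u : K →ₗ[R] M, x • u = f := by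
  have hinj : Function.Injective (LinearMap.lsmul R M x) := hx
  have hmem (k : K) : f k ∈ LinearMap.range (LinearMap.lsmul R M x) := by
    have := LinearMap.congr_fun hf k
    simpa [Submodule.mem_smul_pointwise_iff_exists] using this
  refine ⟨(LinearEquiv.ofInjective _ hinj).symm ∘ₗ f.codRestrict _ hmem, LinearMap.ext fun k ↦ ?_⟩
  exact congrArg Subtype.val
    ((LinearEquiv.ofInjective _ hinj).apply_symm_apply (f.codRestrict _ hmem k))

theorem Submodule.smul_top_mkQ_smul_eq_zero {R : Type u} [CommRing R] {M : Type u} [AddCommGroup M]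
    [Module R M] (x : R) (m : M) : (x • (⊤ : Submodule R M)).mkQ (x • m) = 0 :=
  (Submodule.Quotient.mk_eq_zero _).mpr
    (Submodule.smul_mem_pointwise_smul m x (⊤ : Submodule R M) Submodule.mem_top)

theorem HomAcyclic.exists_mkQ_comp_eq {R : Type u} [CommRing R]
    {M C : Type u} [AddCommGroup M] [Module R M] [AddCommGroup C] [Module R C] {n : ℕ}
    (h : HomAcyclic R M (n + 1) C) {x : R} (hx : IsSMulRegular M x) (f : C →ₗ[R] QuotSMulTop x M) :
    ∃ g : C →ₗ[R] M, (x • (⊤ : Submodule R M)).mkQ ∘ₗ g = f := by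
  cases h with
  | succ n K F C i p hi hp hip hext hK =>
    obtain ⟨h, hh⟩ := Module.projective_lifting_property (x • (⊤ : Submodule R M)).mkQ (f ∘ₗ p)
      (Submodule.mkQ_surjective _)
    obtain ⟨u, hu⟩ := LinearMap.exists_smul_eq_of_mkQ_comp_eq_zero hx (f := h ∘ₗ i) (by
      rw [← LinearMap.comp_assoc, hh, LinearMap.comp_assoc, hip.linearMap_comp_eq_zero,
        LinearMap.comp_zero])
    obtain ⟨g, rfl⟩ := hext u
    have hker : LinearMap.ker p ≤ LinearMap.ker (h - x • g) := by
      intro y hy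
      obtain ⟨k, rfl⟩ := (hip y).mp hy
      have := LinearMap.congr_fun hu k
      simp only [LinearMap.smul_apply, LinearMap.comp_apply] at this
      simp [this]
    refine ⟨(LinearMap.ker p).liftQ (h - x • g) hker ∘ₗ
      (p.quotKerEquivOfSurjective hp).symm.toLinearMap, LinearMap.ext fun c ↦ ?_⟩
    obtain ⟨y, rfl⟩ := hp c
    have hy : (p.quotKerEquivOfSurjective hp).symm (p y) = (LinearMap.ker p).mkQ y := by
      rw [LinearEquiv.symm_apply_eq]; rfl
    have hhy := LinearMap.congr_fun hh y
    simp only [LinearMap.comp_apply] at hhy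
    simp only [LinearMap.comp_apply, LinearEquiv.coe_coe, hy]
    rw [Submodule.mkQ_apply (LinearMap.ker p), Submodule.liftQ_apply, LinearMap.sub_apply, map_sub,
      LinearMap.smul_apply, Submodule.smul_top_mkQ_smul_eq_zero, sub_zero, hhy]

theorem HomAcyclic.quotSMulTop {R : Type u} [CommRing R]
    {M C : Type u} [AddCommGroup M] [Module R M] [AddCommGroup C] [Module R C] {n : ℕ}
    (h : HomAcyclic R M (n + 1) C) {x : R} (hx : IsSMulRegular M x) :
    HomAcyclic R (QuotSMulTop x M) n C := by
  induction n generalizing C with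
  | zero => exact .zero C
  | succ n ih =>
    cases h with
    | succ n K F C i p hi hp hip hext hK =>
      refine .succ n K F C i p hi hp hip (fun f ↦ ?_) (ih hK)
      obtain ⟨f, rfl⟩ := hK.exists_mkQ_comp_eq hx f
      obtain ⟨g, rfl⟩ := hext f
      exact ⟨(x • (⊤ : Submodule R M)).mkQ ∘ₗ g, LinearMap.comp_assoc _ _ _⟩

theorem HomAcyclic.nonempty_quotSMulTop_linearMap_equiv {R : Type u} [CommRing R]
    {M C : Type u} [AddCommGroup M] [Module R M] [AddCommGroup C] [Module R C] {n : ℕ}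
    (h : HomAcyclic R M (n + 1) C) {x : R} (hx : IsSMulRegular M x) :
    Nonempty (QuotSMulTop x (C →ₗ[R] M) ≃ₗ[R] (C →ₗ[R] QuotSMulTop x M)) := by
  let φ : (C →ₗ[R] M) →ₗ[R] (C →ₗ[R] QuotSMulTop x M) :=
    LinearMap.compRight R (x • (⊤ : Submodule R M)).mkQ
  have hφ : LinearMap.ker φ = x • ⊤ := by
    ext f
    rw [Submodule.mem_smul_pointwise_iff_exists]
    constructor
    · intro hf
      obtain ⟨u, hu⟩ := LinearMap.exists_smul_eq_of_mkQ_comp_eq_zero hx (f := f) hf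
      exact ⟨u, trivial, hu⟩
    · rintro ⟨u, -, rfl⟩
      refine LinearMap.ext fun c ↦ ?_
      exact Submodule.smul_top_mkQ_smul_eq_zero x (u c)
  exact ⟨(Submodule.quotEquivOfEq _ _ hφ.symm).trans
    (φ.quotKerEquivOfSurjective fun f ↦ h.exists_mkQ_comp_eq hx f)⟩

theorem subsingleton_residue_hom_linearMap_iff {R : Type u} [CommRing R] [IsNoetherianRing R]
    [IsLocalRing R] {M C : Type u} [AddCommGroup M] [Module R M] [AddCommGroup C] [Module R C]
    [Module.Finite R C] [Nontrivial C] :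
    Subsingleton ((R ⧸ IsLocalRing.maximalIdeal R) →ₗ[R] M) ↔
      Subsingleton ((R ⧸ IsLocalRing.maximalIdeal R) →ₗ[R] (C →ₗ[R] M)) := by
  constructor
  · intro h
    refine subsingleton_of_forall_eq 0 fun f ↦ ?_
    exact LinearMap.ext fun y ↦ LinearMap.ext fun c ↦
      LinearMap.congr_fun (h.elim (f.flip c) 0) y
  · intro h
    have hne : ¬ Subsingleton (C →ₗ[R] (R ⧸ IsLocalRing.maximalIdeal R)) := by
      rw [IsSMulRegular.subsingleton_linearMap_iff]
      rintro ⟨r, hr, hreg⟩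
      have hrm : r ∈ IsLocalRing.maximalIdeal R := by
        refine IsLocalRing.le_maximalIdeal (fun htop ↦ ?_) hr
        exact not_subsingleton C (Module.annihilator_eq_top_iff.mp htop)
      refine one_ne_zero (α := R ⧸ IsLocalRing.maximalIdeal R) (hreg ?_)
      simp only [Algebra.smul_def, mul_one, mul_zero]
      exact Ideal.Quotient.eq_zero_iff_mem.mpr hrm
    rw [not_subsingleton_iff_nontrivial] at hne
    obtain ⟨π, hπ⟩ := exists_ne (0 : C →ₗ[R] (R ⧸ IsLocalRing.maximalIdeal R))
    obtain ⟨c, hc⟩ := DFunLike.ne_iff.mp hπ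
    obtain ⟨b, hb⟩ := Ideal.Quotient.exists_inv hc
    refine subsingleton_of_forall_eq 0 fun f ↦ LinearMap.ext fun y ↦ ?_
    have := LinearMap.congr_fun (LinearMap.congr_fun
      (h.elim (((LinearMap.mul R _).compr₂ f).compl₂ π) 0) (y * b)) c
    simpa [mul_assoc, mul_comm b, hb] using this

theorem HomAcyclic.forall_lt_subsingleton_ext_iff {R : Type u} [CommRing R] [IsNoetherianRing R]
    [IsLocalRing R] {M C : Type u} [AddCommGroup M] [Module R M] [Module.Finite R M]
    [AddCommGroup C] [Module R C] [Module.Finite R C] [Nontrivial C] {n : ℕ}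
    (h : HomAcyclic R M n C) :
    (∀ i < n, Subsingleton (Abelian.Ext (ModuleCat.of R (R ⧸ IsLocalRing.maximalIdeal R))
      (ModuleCat.of R M) i)) ↔
    ∀ i < n, Subsingleton (Abelian.Ext (ModuleCat.of R (R ⧸ IsLocalRing.maximalIdeal R))
      (ModuleCat.of R (C →ₗ[R] M)) i) := by
  induction n generalizing M with
  | zero => simp
  | succ n ih =>
    by_cases h₀ : Subsingleton ((R ⧸ IsLocalRing.maximalIdeal R) →ₗ[R] M)
    · obtain ⟨x, hx, hM⟩ := IsSMulRegular.subsingleton_linearMap_iff.mp h₀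
      have hCM : IsSMulRegular (C →ₗ[R] M) x := fun f g hfg ↦
        LinearMap.ext fun c ↦ hM (LinearMap.congr_fun hfg c)
      obtain ⟨e⟩ := h.nonempty_quotSMulTop_linearMap_equiv hM
      rw [forall_lt_succ_subsingleton_ext_iff _ (ModuleCat.of R M) hx hM,
        forall_lt_succ_subsingleton_ext_iff _ (ModuleCat.of R (C →ₗ[R] M)) hx hCM]
      simp only [subsingleton_ext_congr _ e.toModuleIso]
      exact ih (h.quotSMulTop hM)
    · refine iff_of_false (fun h' ↦ h₀ ?_) fun h' ↦ h₀ ?_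
      · exact (subsingleton_ext_zero_iff _ _).mp (h' 0 n.succ_pos)
      · exact subsingleton_residue_hom_linearMap_iff.mpr
          ((subsingleton_ext_zero_iff _ (ModuleCat.of R (C →ₗ[R] M))).mp (h' 0 n.succ_pos))

end

theorem Module.annihilator_linearMap_eq_of_surjective_evalMap {R : Type u} [CommRing R]
    {C M : Type u} [AddCommGroup C] [Module R C] [AddCommGroup M] [Module R M]
    (h : Function.Surjective (Paper.evalMap R C M)) :
    Module.annihilator R (C →ₗ[R] M) = Module.annihilator R M := by
  ext r
  simp only [Module.mem_annihilator]
  refine ⟨fun hr m ↦ ?_, fun hr f ↦ LinearMap.ext fun c ↦ hr (f c)⟩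
  obtain ⟨t, rfl⟩ := h m
  rw [← map_smul]
  suffices r • t = 0 by rw [this, map_zero]
  induction t with
  | zero => exact smul_zero r
  | tmul c f => rw [← TensorProduct.tmul_smul, hr, TensorProduct.tmul_zero]
  | add t t' ht ht' => rw [smul_add, ht, ht', add_zero]

theorem Paper.natCast_le_ldepth_iff {R : Type u} [CommRing R] [IsLocalRing R]
    {M : Type u} [AddCommGroup M] [Module R M] {n : ℕ} :
    n ≤ ldepth R M ↔
      ∀ i < n, Subsingleton (Abelian.Ext (ModuleCat.of R (R ⧸ IsLocalRing.maximalIdeal R))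
        (ModuleCat.of R M) i) := by
  simp only [← subsingleton_leftDerivedExt_iff]
  refine le_sInf_iff.trans ⟨fun h i hi ↦ ?_, ?_⟩
  · by_contra hne
    exact hi.not_ge (Nat.cast_le.mp (h i ⟨i, rfl, not_subsingleton_iff_nontrivial.mp hne⟩))
  · rintro h _ ⟨i, rfl, hne⟩
    by_contra hi
    exact not_subsingleton_iff_nontrivial.mpr hne (h i (Nat.cast_lt.mp (not_le.mp hi)))

theorem Paper.ldepth_congr {R : Type u} [CommRing R] [IsLocalRing R]
    {M N : Type u} [AddCommGroup M] [Module R M] [AddCommGroup N] [Module R N] (e : M ≃ₗ[R] N) :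
    ldepth R M = ldepth R N :=
  ENat.eq_of_forall_natCast_le_iff fun _ ↦ by
    simp only [natCast_le_ldepth_iff, subsingleton_ext_congr _ e.toModuleIso]

theorem HomAcyclic.ldepth_linearMap {R : Type u} [CommRing R] [IsNoetherianRing R]
    [IsLocalRing R] {M C : Type u} [AddCommGroup M] [Module R M] [Module.Finite R M]
    [AddCommGroup C] [Module R C] [Module.Finite R C] [Nontrivial C]
    (h : ∀ n, HomAcyclic R M n C) : Paper.ldepth R M = Paper.ldepth R (C →ₗ[R] M) :=
  ENat.eq_of_forall_natCast_le_iff fun n ↦ by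
    simp only [Paper.natCast_le_ldepth_iff, (h n).forall_lt_subsingleton_ext_iff]

theorem HomAcyclic.depthAt_linearMap {R : Type u} [CommRing R] [IsNoetherianRing R]
    {M C : Type u} [AddCommGroup M] [Module R M] [Module.Finite R M]
    [AddCommGroup C] [Module R C] [Module.Finite R C] (hC : Module.annihilator R C = ⊥)
    (h : ∀ n, HomAcyclic R M n C) (p : Ideal R) [p.IsPrime] :
    Paper.depthAt R p M = Paper.depthAt R p (C →ₗ[R] M) := by
  have : Nontrivial (LocalizedModule p.primeCompl C) :=
    Module.mem_support_iff.mp ((Module.mem_support_iff_of_finite (p := ⟨p, inferInstance⟩)).mpr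
      (hC.trans_le bot_le))
  have : Module.FinitePresentation R C := Module.finitePresentation_of_finite R C
  have e := IsLocalizedModule.linearEquiv p.primeCompl
    (LocalizedModule.mkLinearMap p.primeCompl (C →ₗ[R] M))
    (LocalizedModule.map p.primeCompl (M := C) (N := M))
  have : IsNoetherianRing (Localization.AtPrime p) :=
    IsLocalization.isNoetherianRing p.primeCompl _ inferInstance
  exact (HomAcyclic.ldepth_linearMap fun n ↦ (h n).localizedModule p.primeCompl).trans
    (Paper.ldepth_congr
      (e.extendScalarsOfIsLocalization p.primeCompl (Localization.AtPrime p)).symm)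

open Paper in
/-- Lemma 3.6: depth, dimension, `(S̃_n)` and Cohen-Macaulayness
pass between `M ∈ B_C` and `Hom_R(C,M)`. -/
theorem stmt_2 (R : Type u) [CommRing R] [IsNoetherianRing R] [IsLocalRing R]
    (C : Type u) [AddCommGroup C] [Module R C] (hC : IsSemidualizing R C)
    (n : ℕ)
    (M : Type u) [AddCommGroup M] [Module R M] [Module.Finite R M]
    (hM : MemBass R C M) :
    -- (i)
    (ldepth R M = ldepth R (C →ₗ[R] M) ∧ moduleDim R M = moduleDim R (C →ₗ[R] M)) ∧
    -- (ii)
    (SerreTilde R n M ↔ SerreTilde R n (C →ₗ[R] M)) ∧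
    -- (iii)
    (IsCMModule R M ↔ IsCMModule R (C →ₗ[R] M)) := by
  obtain ⟨hCfin, hhom, -⟩ := hC
  have hann : Module.annihilator R C = ⊥ := by
    refine (Submodule.eq_bot_iff _).mpr fun r hr ↦ hhom.1 (LinearMap.ext fun c ↦ ?_)
    simpa using Module.mem_annihilator.mp hr c
  have : Nontrivial C := by
    by_contra hC
    rw [not_nontrivial_iff_subsingleton, ← Module.annihilator_eq_top_iff (R := R), hann] at hC
    exact bot_ne_top hC
  have hacyc := HomAcyclic.of_subsingleton_ext M C fun i hi ↦
    (subsingleton_leftDerivedExt_iff _ _ i).mp (hM.2.2 i hi)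
  have hdepth := HomAcyclic.ldepth_linearMap hacyc
  have hdim : moduleDim R M = moduleDim R (C →ₗ[R] M) := by
    rw [moduleDim, moduleDim, Module.annihilator_linearMap_eq_of_surjective_evalMap hM.1.2]
  refine ⟨⟨hdepth, hdim⟩, forall₂_congr fun p hp ↦ ?_, ?_⟩
  · rw [HomAcyclic.depthAt_linearMap hann hacyc p]
  · rw [IsCMModule, IsCMModule, hdepth, hdim]
end
end

section
/- Let R be a commutative Noetherian semiperfect ring and C a semidualizing R-module such that id_{R_p}(C_p) < ∞ for all p ∈ X^1(R). Let M be a finitely generated R-module in the Bass class B_C which is a C-syzygy. If M is C-stable and underline-Hom_R(Hom_R(C,M), C) = 0 = Ext^1_R(M,C), then M is horizontally linked with respect to C. -/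
/- Preliminary definitions for formalizing
   "Linkage of modules with respect to a semidualizing module"
   (Dibaei–Sadeghi). -/

open CategoryTheory

universe u
noncomputable section
namespace Paper

open Limits

section Resolutions

variable (R : Type u) [CommRing R]

lemma exists_resolution_step (A : ModuleCat.{u} R) (Q : ProjectiveResolution A) :
    ∃ ε : Q.complex.X 0 →ₗ[R] A, Module.Projective R (Q.complex.X 0) ∧ Function.Surjective ε ∧
    Function.Exact (Q.complex.d 1 0).hom ε := by
  refine ⟨(Q.π.f 0).hom, ?_, (ModuleCat.epi_iff_surjective _).1 inferInstance, ?_⟩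
  · exact (IsProjective.iff_projective _).2 (Q.projective 0)
  · exact (ShortComplex.ShortExact.moduleCat_exact_iff_function_exact _).1 Q.exact₀

/-- If `Ext¹(M, C) = 0` then for some projective `F → M` the maps from its kernel to `C` extend. -/
theorem exists_extend_of_ext (M C : Type u) [AddCommGroup M] [Module R M] [AddCommGroup C]
    [Module R C] (h : Subsingleton (ExtGrp R M C 1)) :
    ∃ (F : ModuleCat.{u} R) (ε : F →ₗ[R] M), Module.Projective R F ∧ Function.Surjective ε ∧
      ∀ φ : LinearMap.ker ε →ₗ[R] C, ∃ e : F →ₗ[R] C, ∀ x : LinearMap.ker ε, e x = φ x := by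
  let Q := ProjectiveResolution.of (ModuleCat.of R M)
  have h0 : IsZero ((Q.complex.linearYonedaObj R (ModuleCat.of R C)).homology 1) :=
    (ModuleCat.isZero_of_subsingleton _).of_iso (Q.isoExt 1 _).symm
  rw [← HomologicalComplex.exactAt_iff_isZero_homology,
    HomologicalComplex.exactAt_iff' _ 0 1 2 (by simp) (by simp),
    ShortComplex.ShortExact.moduleCat_exact_iff_function_exact] at h0
  obtain ⟨ε, hp, hs, hex⟩ := exists_resolution_step R _ Q
  refine ⟨_, ε, hp, hs, fun φ => ?_⟩
  have hd : ∀ x, (Q.complex.d 1 0).hom x ∈ LinearMap.ker ε := fun x => hex.apply_apply_eq_zero x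
  let ψ : Q.complex.X 1 ⟶ ModuleCat.of R C :=
    ModuleCat.ofHom (φ ∘ₗ (Q.complex.d 1 0).hom.codRestrict _ hd)
  have hψ : Q.complex.d 2 1 ≫ ψ = 0 := by
    ext x
    have hx : (Q.complex.d 1 0).hom.codRestrict (LinearMap.ker ε) hd
        ((Q.complex.d 2 1).hom x) = 0 := by
      ext
      exact congr($(Q.complex.d_comp_d 2 1 0) x)
    exact (congrArg φ hx).trans (map_zero φ)
  obtain ⟨e, he⟩ := (h0 ψ).1 hψ
  change Q.complex.d 1 0 ≫ e = ψ at he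
  refine ⟨e.hom, fun x => ?_⟩
  obtain ⟨y, hy⟩ := (hex x).1 x.2
  have h1 : e.hom ((Q.complex.d 1 0).hom y) = φ ⟨(Q.complex.d 1 0).hom y, hd y⟩ :=
    congr($he y)
  rw [← hy, h1]
  congr 1
  exact Subtype.ext hy

/-- If `Tor₁(X, C) = 0` then some projective `F → C` has a kernel that stays embedded after `X ⊗ -`. -/
theorem exists_lTensor_ker_injective_of_tor (X C : Type u) [AddCommGroup X] [Module R X]
    [AddCommGroup C] [Module R C] (h : Subsingleton (TorGrp R X C 1)) :
    ∃ (F : ModuleCat.{u} R) (ε : F →ₗ[R] C), Module.Projective R F ∧ Function.Surjective ε ∧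
      Function.Injective ((LinearMap.ker ε).subtype.lTensor X) := by
  let Q := ProjectiveResolution.of (ModuleCat.of R C)
  have h' : IsZero (((Tor (ModuleCat.{u} R) 1).obj (ModuleCat.of R X)).obj (ModuleCat.of R C)) :=
    ModuleCat.isZero_of_subsingleton _
  have h0 := h'.of_iso
    (Q.isoLeftDerivedObj ((MonoidalCategory.tensoringLeft _).obj (ModuleCat.of R X)) 1).symm
  replace h0 : IsZero (((((MonoidalCategory.tensoringLeft _).obj
      (ModuleCat.of R X)).mapHomologicalComplex _).obj Q.complex).homology 1) := h0
  rw [← HomologicalComplex.exactAt_iff_isZero_homology,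
    HomologicalComplex.exactAt_iff' _ 2 1 0 (by simp) (by simp),
    ShortComplex.ShortExact.moduleCat_exact_iff_function_exact] at h0
  obtain ⟨ε, hp, hs, hex⟩ := exists_resolution_step R _ Q
  refine ⟨_, ε, hp, hs, ?_⟩
  have hd : ∀ x, (Q.complex.d 1 0).hom x ∈ LinearMap.ker ε := fun x => hex.apply_apply_eq_zero x
  let δ := (Q.complex.d 1 0).hom.codRestrict _ hd
  have hδ : Function.Surjective δ := fun x => by
    obtain ⟨y, hy⟩ := (hex x).1 x.2
    exact ⟨y, Subtype.ext hy⟩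
  have h0' : Function.Exact ((Q.complex.d 2 1).hom.lTensor X) ((Q.complex.d 1 0).hom.lTensor X) :=
    h0
  rw [injective_iff_map_eq_zero]
  intro z hz
  obtain ⟨y, rfl⟩ := LinearMap.lTensor_surjective X hδ z
  have hy : (Q.complex.d 1 0).hom.lTensor X y = 0 := by
    rw [← hz, ← LinearMap.comp_apply, ← LinearMap.lTensor_comp]
    rfl
  obtain ⟨w, rfl⟩ := (h0' y).1 hy
  have hc : δ ∘ₗ (Q.complex.d 2 1).hom = 0 := by
    ext x
    exact congr($(Q.complex.d_comp_d 2 1 0) x)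
  rw [← LinearMap.comp_apply, ← LinearMap.lTensor_comp, hc, LinearMap.lTensor_zero,
    LinearMap.zero_apply]

end Resolutions

section Extension

variable {R : Type u} [CommRing R]

lemma exists_factor_of_ker_le {A B D : Type*} [AddCommGroup A] [Module R A] [AddCommGroup B]
    [Module R B] [AddCommGroup D] [Module R D] {f : A →ₗ[R] B} (hf : Function.Surjective f)
    {m : A →ₗ[R] D} (h : LinearMap.ker f ≤ LinearMap.ker m) : ∃ E : B →ₗ[R] D, E ∘ₗ f = m := by
  refine ⟨(LinearMap.ker f).liftQ m h ∘ₗ (f.quotKerEquivOfSurjective hf).symm.toLinearMap, ?_⟩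
  ext x
  have hx : (f.quotKerEquivOfSurjective hf).symm (f x) = (LinearMap.ker f).mkQ x := by
    rw [LinearEquiv.symm_apply_eq]
    rfl
  simp [hx]

/-- If `Ext¹(M, C) = 0` then every homomorphism to `C` from the kernel of a surjection `B → M`
extends to `B`. -/
theorem exists_extend_ker_of_ext {M C : Type u} [AddCommGroup M] [Module R M] [AddCommGroup C]
    [Module R C] (h : Subsingleton (ExtGrp R M C 1)) {B : Type*} [AddCommGroup B] [Module R B]
    {p : B →ₗ[R] M} (hp : Function.Surjective p) (φ : LinearMap.ker p →ₗ[R] C) :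
    ∃ E : B →ₗ[R] C, ∀ x : LinearMap.ker p, E x = φ x := by
  obtain ⟨F, ε, hF, hs, hext⟩ := exists_extend_of_ext R M C h
  obtain ⟨l, hl⟩ := Module.projective_lifting_property p ε hp
  have hl' : ∀ x, p (l x) = ε x := fun x => congr($hl x)
  have hmem : ∀ x ∈ LinearMap.ker ε, l x ∈ LinearMap.ker p := fun x hx => by
    simpa [hl'] using hx
  obtain ⟨e, he⟩ := hext (φ ∘ₗ l.restrict hmem)
  have hε : Function.Surjective ((LinearMap.ker p).subtype.coprod l) := fun b => by
    obtain ⟨x, hx⟩ := hs (p b)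
    exact ⟨(⟨b - l x, by simp [hl', hx]⟩, x), by simp⟩
  obtain ⟨E, hE⟩ := exists_factor_of_ker_le hε (m := φ.coprod e) (by
    rintro ⟨a, x⟩ hax
    have hax' : (a : B) + l x = 0 := by simpa using hax
    have hx : x ∈ LinearMap.ker ε := by
      rw [LinearMap.mem_ker, ← hl', eq_neg_of_add_eq_zero_right hax', map_neg, a.2, neg_zero]
    have h1 : e x = φ (-a) := by
      rw [he ⟨x, hx⟩, LinearMap.comp_apply]
      congr 1
      exact Subtype.ext (eq_neg_of_add_eq_zero_right hax')
    simp [h1])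
  refine ⟨E, fun x => ?_⟩
  simpa using congr($hE (x, 0))

open TensorProduct

/-- Balancing of `Tor₁`, in elementary form. -/
theorem rTensor_ker_injective_of_lTensor_ker_injective {X C F P : Type*} [AddCommGroup X]
    [Module R X] [AddCommGroup C] [Module R C] [AddCommGroup F] [Module R F] [AddCommGroup P]
    [Module R P] [Module.Flat R F] [Module.Flat R P] {ε : F →ₗ[R] C}
    (hε : Function.Surjective ε) (hinj : Function.Injective ((LinearMap.ker ε).subtype.lTensor X))
    {g : P →ₗ[R] X} (hg : Function.Surjective g) :
    Function.Injective ((LinearMap.ker g).subtype.rTensor C) := by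
  rw [injective_iff_map_eq_zero] at hinj ⊢
  intro z hz
  have hK : Function.Exact (LinearMap.ker g).subtype g := LinearMap.exact_subtype_ker_map g
  have hL : Function.Exact (LinearMap.ker ε).subtype ε := LinearMap.exact_subtype_ker_map ε
  obtain ⟨z, rfl⟩ := LinearMap.lTensor_surjective _ hε z
  have h1 : ε.lTensor P ((LinearMap.ker g).subtype.rTensor F z) = 0 := by
    rw [← hz]
    simp only [← LinearMap.comp_apply, LinearMap.lTensor_comp_rTensor,
      LinearMap.rTensor_comp_lTensor]
  obtain ⟨w, hw⟩ := (lTensor_exact P hL hε _).1 h1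
  have h2 : g.rTensor (LinearMap.ker ε) w = 0 := by
    apply hinj
    have h3 : g.rTensor F ((LinearMap.ker g).subtype.rTensor F z) = 0 :=
      (rTensor_exact F hK hg).apply_apply_eq_zero z
    rw [← hw] at h3
    rw [← h3]
    simp only [← LinearMap.comp_apply, LinearMap.lTensor_comp_rTensor,
      LinearMap.rTensor_comp_lTensor]
  obtain ⟨k, rfl⟩ := (rTensor_exact (LinearMap.ker ε) hK hg _).1 h2
  have h4 : z = (LinearMap.ker ε).subtype.lTensor (LinearMap.ker g) k := by
    apply Module.Flat.rTensor_preserves_injective_linearMap (M := F) _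
      (LinearMap.ker g).injective_subtype
    rw [← hw]
    simp only [← LinearMap.comp_apply, LinearMap.lTensor_comp_rTensor,
      LinearMap.rTensor_comp_lTensor]
  rw [h4]
  exact (lTensor_exact _ hL hε).apply_apply_eq_zero k

end Extension

section Covers

variable {R : Type u} [CommRing R]

lemma IsSemiperfectRing.exists_isIdempotentElem_mul (h : IsSemiperfectRing R) {a : R}
    (ha : a ∉ (⊥ : Ideal R).jacobson) : ∃ b, IsIdempotentElem (a * b) ∧ a * b ≠ 0 := by
  obtain ⟨n, A, c, hA, ⟨e⟩⟩ := h
  by_cases hu : ∃ i, IsUnit (e a i)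
  · obtain ⟨i, hi⟩ := hu
    obtain ⟨v, hv⟩ := hi.exists_right_inv
    have := hA i
    have hab : e (a * e.symm (Pi.single i v)) = Pi.single i 1 := by
      rw [map_mul, e.apply_symm_apply, ← hv]
      ext j
      by_cases hj : j = i
      · subst hj
        simp
      · simp [hj]
    refine ⟨e.symm (Pi.single i v), ?_, fun h0 => ?_⟩
    · apply e.injective
      rw [map_mul, hab, ← Pi.single_mul, one_mul]
    · rw [h0, map_zero] at hab
      exact zero_ne_one (α := A i) (by simpa using congr($hab i))
  · refine absurd ?_ ha
    rw [Ideal.mem_jacobson_bot]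
    intro y
    rw [← MulEquiv.isUnit_map e, Pi.isUnit_iff]
    intro i
    have := hA i
    have hn : ¬ IsUnit (e a i * e y i) := fun hy => hu ⟨i, isUnit_of_mul_isUnit_left hy⟩
    have h1 : IsUnit ((e a i * e y i + 1) + -(e a i * e y i)) := by
      rw [add_neg_cancel_comm]
      exact isUnit_one
    simpa using (IsLocalRing.isUnit_or_isUnit_of_isUnit_add h1).resolve_right (by simpa using hn)

lemma exists_dual_basis (P : Type*) [AddCommGroup P] [Module R P] [Module.Finite R P]
    [Module.Projective R P] : ∃ (n : ℕ) (b : Fin n → P) (β : Fin n → Module.Dual R P),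
      ∀ x, ∑ i, β i x • b i = x := by
  obtain ⟨n, f, hf⟩ := Module.Finite.exists_fin' R P
  obtain ⟨s, hs⟩ := Module.projective_lifting_property f LinearMap.id hf
  refine ⟨n, fun i => f (Pi.single i 1), fun i => LinearMap.proj i ∘ₗ s, fun x => ?_⟩
  have hx : f (s x) = x := congr($hs x)
  conv_rhs => rw [← hx, pi_eq_sum_univ' (s x), map_sum]
  simp

lemma dual_eq_sum {P : Type*} [AddCommGroup P] [Module R P] {n : ℕ} {b : Fin n → P}
    {β : Fin n → Module.Dual R P} (h : ∀ x, ∑ i, β i x • b i = x) (θ : Module.Dual R P) :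
    ∑ i, θ (b i) • β i = θ := by
  ext x
  conv_rhs => rw [← h x, map_sum]
  simp [mul_comm]

lemma eq_top_of_sup_eq_top {P : Type*} [AddCommGroup P] [Module R P] [Module.Finite R P]
    {K N : Submodule R P} (hK : K ≤ (⊥ : Ideal R).jacobson • ⊤) (h : N ⊔ K = ⊤) : N = ⊤ := by
  rw [eq_top_iff]
  refine Submodule.le_of_le_smul_of_le_jacobson_bot Module.Finite.fg_top le_rfl ?_
  rw [← h]
  exact sup_le_sup_left (h ▸ hK) _

lemma projective_quotient_span_singleton {P : Type*} [AddCommGroup P] [Module R P]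
    [Module.Projective R P] {y : P} {ψ : P →ₗ[R] R} (h : ψ y • y = y) :
    Module.Projective R (P ⧸ Submodule.span R {y}) := by
  refine Module.Projective.of_split
    ((Submodule.span R {y}).liftQ (LinearMap.id - ψ.smulRight y) ?_)
    (Submodule.span R {y}).mkQ ?_
  · rw [Submodule.span_singleton_le_iff_mem]
    simp [h]
  · have hy : (Submodule.Quotient.mk y : P ⧸ Submodule.span R {y}) = 0 :=
      (Submodule.Quotient.mk_eq_zero _).2 (Submodule.mem_span_singleton_self y)
    ext x
    simp [hy]

/-- A finitely generated module over a Noetherian semiperfect ring has a projective cover. -/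
theorem exists_projective_cover [IsNoetherianRing R] (hR : IsSemiperfectRing R) (X : Type u)
    [AddCommGroup X] [Module R X] [Module.Finite R X] :
    ∃ (P : ModuleCat.{u} R) (g : P →ₗ[R] X), Module.Finite R P ∧ Module.Projective R P ∧
      Function.Surjective g ∧ LinearMap.ker g ≤ (⊥ : Ideal R).jacobson • ⊤ := by
  obtain ⟨n, f, hf⟩ := Module.Finite.exists_fin' R X
  obtain ⟨S, ⟨hSf, hSp⟩, hmax⟩ := set_has_maximal_iff_noetherian.2
    (inferInstance : IsNoetherian R (Fin n → R))
    {S | S ≤ LinearMap.ker f ∧ Module.Projective R ((Fin n → R) ⧸ S)}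
    ⟨⊥, bot_le, Module.Projective.of_equiv (Submodule.quotEquivOfEqBot ⊥ rfl).symm⟩
  refine ⟨ModuleCat.of R ((Fin n → R) ⧸ S), S.liftQ f hSf,
    inferInstanceAs (Module.Finite R ((Fin n → R) ⧸ S)), hSp, fun x => ?_, fun x hx => ?_⟩
  · obtain ⟨y, rfl⟩ := hf x
    exact ⟨S.mkQ y, by simp⟩
  change x ∈ LinearMap.ker (S.liftQ f hSf) at hx
  change x ∈ (⊥ : Ideal R).jacobson • (⊤ : Submodule R ((Fin n → R) ⧸ S))
  by_contra hxJ
  obtain ⟨m, b, β, hb⟩ := exists_dual_basis (R := R) ((Fin n → R) ⧸ S)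
  obtain ⟨i, hi⟩ : ∃ i, β i x ∉ (⊥ : Ideal R).jacobson := by
    by_contra! hall
    apply hxJ
    rw [← hb x]
    exact Submodule.sum_mem _ fun i _ => Submodule.smul_mem_smul (hall i) trivial
  obtain ⟨a, hid, hne⟩ := hR.exists_isIdempotentElem_mul hi
  set e := β i x * a with he
  have hψ : (a • β i) (e • x) = e := by
    rw [map_smul, LinearMap.smul_apply, smul_eq_mul, smul_eq_mul, mul_comm a, ← he]
    exact hid
  have hT : S ≤ (Submodule.span R {e • x}).comap S.mkQ := fun s hs => by
    simp [(Submodule.Quotient.mk_eq_zero S).2 hs]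
  refine hmax ((Submodule.span R {e • x}).comap S.mkQ) ⟨?_, ?_⟩ (lt_of_le_of_ne hT ?_)
  · intro s hs
    rw [Submodule.mem_comap, Submodule.mem_span_singleton] at hs
    obtain ⟨r, hr⟩ := hs
    rw [LinearMap.mem_ker, ← S.liftQ_apply f (h := hSf), ← S.mkQ_apply, ← hr, map_smul, map_smul,
      hx, smul_zero, smul_zero]
  · have := projective_quotient_span_singleton (y := e • x) (ψ := a • β i) (by
      rw [hψ, smul_smul, hid.eq])
    have hmap : ((Submodule.span R {e • x}).comap S.mkQ).map S.mkQ = Submodule.span R {e • x} :=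
      Submodule.map_comap_eq_of_surjective S.mkQ_surjective _
    exact Module.Projective.of_equiv ((Submodule.quotEquivOfEq _ _ hmap.symm).trans
      (Submodule.quotientQuotientEquivQuotient S _ hT))
  · intro hS
    obtain ⟨v, hv⟩ := S.mkQ_surjective (e • x)
    have hvS : v ∈ S := by
      rw [hS, Submodule.mem_comap, hv]
      exact Submodule.mem_span_singleton_self _
    have h0 : e • x = 0 := by rw [← hv]; simpa using hvS
    rw [h0, map_zero] at hψ
    exact hne hψ.symm

end Covers

section Linkage

open TensorProduct

variable {R : Type u} [CommRing R]

lemma finite_linearMap [IsNoetherianRing R] (A B : Type*) [AddCommGroup A] [Module R A]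
    [Module.Finite R A] [AddCommGroup B] [Module R B] [Module.Finite R B] :
    Module.Finite R (A →ₗ[R] B) := by
  obtain ⟨n, f, hf⟩ := Module.Finite.exists_fin' R A
  exact Module.Finite.of_injective (LinearMap.lcomp R B f)
    (LinearMap.lcomp_injective_of_surjective f hf)

/-- A minimal presentation assembled from two projective covers. -/
def MinPres.ofCovers {X P₀ P₁ : Type u} [AddCommGroup X] [Module R X] [AddCommGroup P₀]
    [Module R P₀] [AddCommGroup P₁] [Module R P₁] [Module.Finite R P₀] [Module.Finite R P₁]
    [Module.Projective R P₀] [Module.Projective R P₁] {g : P₀ →ₗ[R] X}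
    (hg : Function.Surjective g) (hg' : LinearMap.ker g ≤ (⊥ : Ideal R).jacobson • ⊤)
    {h : P₁ →ₗ[R] LinearMap.ker g} (hh : Function.Surjective h)
    (hh' : LinearMap.ker h ≤ (⊥ : Ideal R).jacobson • ⊤) : MinPres R X where
  P₁ := P₁
  P₀ := P₀
  f := (LinearMap.ker g).subtype ∘ₗ h
  g := g
  finite₁ := inferInstance
  finite₀ := inferInstance
  proj₁ := inferInstance
  proj₀ := inferInstance
  surj := hg
  exact := by
    rw [LinearMap.range_comp, LinearMap.range_eq_top.2 hh, Submodule.map_top,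
      Submodule.range_subtype]
  min₀ N hN := eq_top_of_sup_eq_top hg' hN
  min₁ N hN := eq_top_of_sup_eq_top hh' (by
    rwa [LinearMap.ker_comp_of_ker_eq_bot _ (LinearMap.ker_eq_bot.2 Subtype.val_injective)] at hN)

lemma nonempty_minPres [IsNoetherianRing R] (hR : IsSemiperfectRing R) (X : Type u)
    [AddCommGroup X] [Module R X] [Module.Finite R X] : Nonempty (MinPres R X) := by
  obtain ⟨P, g, _, _, hg, hg'⟩ := exists_projective_cover hR X
  obtain ⟨Q, h, _, _, hh, hh'⟩ := exists_projective_cover hR (LinearMap.ker g)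
  exact ⟨MinPres.ofCovers hg hg' hh hh'⟩

lemma exists_minPres_of_cover [IsNoetherianRing R] (hR : IsSemiperfectRing R) {X P₀ : Type u}
    [AddCommGroup X] [Module R X] [AddCommGroup P₀] [Module R P₀] [Module.Finite R P₀]
    [Module.Projective R P₀] {g : P₀ →ₗ[R] X} (hg : Function.Surjective g)
    (hg' : LinearMap.ker g ≤ (⊥ : Ideal R).jacobson • ⊤) (C : Type u) [AddCommGroup C]
    [Module R C] :
    ∃ (Q : ModuleCat.{u} R) (f : Q →ₗ[R] P₀), LinearMap.range f = LinearMap.ker g ∧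
      ∃ pres : MinPres R X, Nonempty (LinearMap.range (LinearMap.lcomp R C f) ≃ₗ[R]
        LinearMap.range (pres.homC C)) := by
  obtain ⟨Q, h, _, _, hh, hh'⟩ := exists_projective_cover hR (LinearMap.ker g)
  let pres := MinPres.ofCovers hg hg' hh hh'
  exact ⟨Q, pres.f, pres.exact, pres, ⟨LinearEquiv.refl R _⟩⟩

lemma range_equiv_of_ker_eq {A B D : Type*} [AddCommGroup A] [Module R A] [AddCommGroup B]
    [Module R B] [AddCommGroup D] [Module R D] {π : A →ₗ[R] B} (hπ : Function.Surjective π)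
    {Φ : A →ₗ[R] D} (h : LinearMap.ker π = LinearMap.ker Φ) :
    Nonempty (B ≃ₗ[R] LinearMap.range Φ) :=
  ⟨(π.quotKerEquivOfSurjective hπ).symm ≪≫ₗ Submodule.quotEquivOfEq _ _ h ≪≫ₗ
    Φ.quotKerEquivRange⟩

/-- A module `X` such that `X ⊗ C ≅ M` is `C`-stable has no nonzero cyclic projective summand, so
functionals on `X` take values in the Jacobson radical. -/
theorem mem_jacobson_of_isCStable (hR : IsSemiperfectRing R) {C M X : Type u} [AddCommGroup C]
    [Module R C] [AddCommGroup M] [Module R M] [AddCommGroup X] [Module R X]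
    (hC : Function.Injective (LinearMap.lsmul R C)) (hM : IsCStable R C M) (μ : X ⊗[R] C ≃ₗ[R] M)
    (ψ : X →ₗ[R] R) (x : X) : ψ x ∈ (⊥ : Ideal R).jacobson := by
  by_contra hx
  obtain ⟨b, hid, hne⟩ := hR.exists_isIdempotentElem_mul hx
  set e := ψ x * b with he
  let I : Ideal R := Ideal.span {e}
  have heI : e ∈ I := Ideal.mem_span_singleton_self e
  have hI : ∀ r : I, (r : R) * e = r := fun r => by
    obtain ⟨s, hs⟩ := Ideal.mem_span_singleton'.1 r.2
    rw [← hs, mul_assoc, hid.eq]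
  let ρ : R →ₗ[R] I := LinearMap.toSpanSingleton R I ⟨e, heI⟩
  have hI' : Module.Projective R I := Module.Projective.of_split I.subtype ρ (by
    ext r
    simp [ρ, hI])
  let i : I →ₗ[R] X := (LinearMap.toSpanSingleton R X x) ∘ₗ I.subtype
  let s : X →ₗ[R] I := ρ ∘ₗ (b • ψ)
  have hsi : s ∘ₗ i = LinearMap.id := by
    ext r
    simp only [s, i, ρ, LinearMap.comp_apply, LinearMap.toSpanSingleton_apply,
      Submodule.subtype_apply, map_smul, LinearMap.smul_apply, LinearMap.id_apply,
      SetLike.val_smul, smul_eq_mul]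
    rw [mul_comm b, ← he, hid.eq, hI]
  let α : I ⊗[R] C →ₗ[R] M := μ.toLinearMap ∘ₗ i.rTensor C
  let β : M →ₗ[R] I ⊗[R] C := s.rTensor C ∘ₗ μ.symm.toLinearMap
  have hβα : ∀ z, β (α z) = z := fun z => by
    have : s.rTensor C (i.rTensor C z) = z := by
      rw [← LinearMap.comp_apply, ← LinearMap.rTensor_comp, hsi, LinearMap.rTensor_id,
        LinearMap.id_apply]
    simpa [α, β] using this
  have hα : Function.Injective α := Function.LeftInverse.injective hβα
  have hcompl : IsCompl (LinearMap.range α) (LinearMap.ker β) := by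
    rw [isCompl_iff, Submodule.disjoint_def, Submodule.codisjoint_iff_exists_add_eq]
    refine ⟨?_, fun m => ⟨α (β m), m - α (β m), ⟨_, rfl⟩, ?_, by simp⟩⟩
    · rintro _ ⟨z, rfl⟩ hz
      rw [LinearMap.mem_ker, hβα] at hz
      rw [hz, map_zero]
    · simp [hβα]
  have hbot := hM _ _ hcompl (ModuleCat.of R I) hI' ⟨(LinearEquiv.ofInjective α hα).symm⟩
  apply hne
  apply hC
  ext c
  have h0 : (⟨e, heI⟩ : I) ⊗ₜ[R] c = 0 := by
    apply hα
    rw [LinearMap.range_eq_bot.1 hbot]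
    rfl
  simpa using congr(TensorProduct.lift ((LinearMap.lsmul R C) ∘ₗ I.subtype) $h0)

/-- Elements of `P ⊗ C` with `P` projective are detected by functionals on `P`. -/
lemma eq_zero_of_forall_dual_rTensor {P C : Type*} [AddCommGroup P] [Module R P]
    [Module.Projective R P] [AddCommGroup C] [Module R C] {z : P ⊗[R] C}
    (h : ∀ l : P →ₗ[R] R, l.rTensor C z = 0) : z = 0 := by
  classical
  obtain ⟨s, hs⟩ := Module.projective_def'.1 (inferInstance : Module.Projective R P)
  have hz : s.rTensor C z = 0 := by
    apply (TensorProduct.finsuppLeft R R R C P).injective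
    rw [map_zero]
    ext i
    rw [TensorProduct.finsuppLeft_apply, Finsupp.zero_apply, ← LinearMap.comp_apply,
      ← LinearMap.rTensor_comp]
    exact h _
  rw [← LinearMap.id_apply (R := R) z, ← LinearMap.rTensor_id, ← hs, LinearMap.rTensor_comp,
    LinearMap.comp_apply, hz, map_zero]

lemma exists_smul_eq_of_homothety {A C : Type*} [AddCommGroup A] [Module R A]
    [AddCommGroup C] [Module R C] (hC : Function.Bijective (LinearMap.lsmul R C)) (B : A →ₗ[R] C →ₗ[R] C) :
    ∃ a : A →ₗ[R] R, ∀ x c, a x • c = B x c := by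
  let h := LinearEquiv.ofBijective (LinearMap.lsmul R C) hC
  exact ⟨h.symm.toLinearMap ∘ₗ B, fun x c => congr($(h.apply_symm_apply (B x)) c)⟩

section BassClass

variable {C M : Type u} [AddCommGroup C] [Module R C] [AddCommGroup M] [Module R M]

/-- The evaluation isomorphism `Hom(C, M) ⊗ C ≅ M` for `M` in the Bass class. -/
def MemBass.evalEquiv (hB : MemBass R C M) : (C →ₗ[R] M) ⊗[R] C ≃ₗ[R] M :=
  TensorProduct.comm R _ _ ≪≫ₗ LinearEquiv.ofBijective (evalMap R C M) hB.1

lemma MemBass.lift_eq (hB : MemBass R C M) {P : Type*} [AddCommGroup P] [Module R P]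
    (g : P →ₗ[R] C →ₗ[R] M) : TensorProduct.lift g = hB.evalEquiv.toLinearMap ∘ₗ g.rTensor C := by
  ext p c
  simp [evalEquiv, evalMap]

lemma MemBass.ker_lift (hB : MemBass R C M) {P : Type*} [AddCommGroup P] [Module R P]
    (g : P →ₗ[R] C →ₗ[R] M) :
    LinearMap.ker (TensorProduct.lift g) = LinearMap.ker (g.rTensor C) := by
  rw [hB.lift_eq, LinearMap.ker_comp_of_ker_eq_bot _ hB.evalEquiv.ker]

lemma MemBass.lift_surjective (hB : MemBass R C M) {P : Type*} [AddCommGroup P] [Module R P]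
    {g : P →ₗ[R] C →ₗ[R] M} (hg : Function.Surjective g) :
    Function.Surjective (TensorProduct.lift g) := by
  rw [hB.lift_eq]
  exact hB.evalEquiv.surjective.comp (LinearMap.rTensor_surjective C hg)

/-- For `M` in the Bass class with `Ext¹(M, C) = 0`, the group `Ext¹(Hom(C, M), R)` vanishes:
functionals on the first syzygy extend to the projective module. -/
theorem MemBass.exists_extend_ker (hB : MemBass R C M)
    (hC : Function.Bijective (LinearMap.lsmul R C)) (hext : Subsingleton (ExtGrp R M C 1))
    {P : Type u} [AddCommGroup P] [Module R P] [Module.Projective R P] {g : P →ₗ[R] C →ₗ[R] M}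
    (hg : Function.Surjective g) (h : LinearMap.ker g →ₗ[R] R) :
    ∃ h' : P →ₗ[R] R, ∀ k : LinearMap.ker g, h' k = h k := by
  obtain ⟨F, ε, _, hε, hinj⟩ := exists_lTensor_ker_injective_of_tor R _ C (hB.2.1 1 one_pos)
  have hinj' := rTensor_ker_injective_of_lTensor_ker_injective hε hinj hg
  have hex : Function.Exact ((LinearMap.ker g).subtype.rTensor C) (TensorProduct.lift g) := by
    rw [LinearMap.exact_iff, hB.ker_lift, ← LinearMap.exact_iff]
    exact rTensor_exact C (LinearMap.exact_subtype_ker_map g) hg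
  let i : LinearMap.ker g ⊗[R] C →ₗ[R] LinearMap.ker (TensorProduct.lift g) :=
    ((LinearMap.ker g).subtype.rTensor C).codRestrict _ hex.apply_apply_eq_zero
  have hi : Function.Bijective i :=
    ⟨fun x y hxy => hinj' congr(($hxy : P ⊗[R] C)), fun z => by
      obtain ⟨y, hy⟩ := (hex z).1 z.2
      exact ⟨y, Subtype.ext hy⟩⟩
  let j := LinearEquiv.ofBijective i hi
  obtain ⟨E, hE⟩ := exists_extend_ker_of_ext hext (hB.lift_surjective hg)
    (TensorProduct.lift (LinearMap.lsmul R C ∘ₗ h) ∘ₗ j.symm.toLinearMap)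
  obtain ⟨h', hh'⟩ := exists_smul_eq_of_homothety hC (TensorProduct.curry E)
  refine ⟨h', fun k => hC.1 ?_⟩
  ext c
  have h1 := hE (j (k ⊗ₜ c))
  rw [LinearMap.comp_apply, LinearEquiv.coe_coe, j.symm_apply_apply] at h1
  rw [LinearMap.lsmul_apply, hh', TensorProduct.curry_apply]
  exact h1

/-- For `M` a `C`-syzygy in the Bass class, the kernel of `P ⊗ C → M` is cut out by the functionals
on `P` that factor through `Hom(C, M)`. -/
theorem MemBass.mem_ker_lift_iff (hB : MemBass R C M)
    (hC : Function.Bijective (LinearMap.lsmul R C)) (hsyz : IsCSyzygy R C M)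
    {P : Type*} [AddCommGroup P] [Module R P] (g : P →ₗ[R] C →ₗ[R] M) (z : P ⊗[R] C) :
    z ∈ LinearMap.ker (TensorProduct.lift g) ↔
      ∀ ψ : (C →ₗ[R] M) →ₗ[R] R, (ψ ∘ₗ g).rTensor C z = 0 := by
  constructor
  · intro hz ψ
    rw [hB.ker_lift, LinearMap.mem_ker] at hz
    rw [LinearMap.rTensor_comp, LinearMap.comp_apply, hz, map_zero]
  · intro hz
    obtain ⟨Q, hQ, ι, hι⟩ := hsyz
    rw [LinearMap.mem_ker]
    apply hι
    rw [map_zero]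
    refine eq_zero_of_forall_dual_rTensor fun l => ?_
    let t : Q ⊗[R] C →ₗ[R] C := (TensorProduct.lid R C).toLinearMap ∘ₗ l.rTensor C
    obtain ⟨ψ, hψ⟩ := exists_smul_eq_of_homothety hC
      (LinearMap.compRight R (M := C) (t ∘ₗ ι))
    have key : t ∘ₗ ι ∘ₗ TensorProduct.lift g =
        (TensorProduct.lid R C).toLinearMap ∘ₗ (ψ ∘ₗ g).rTensor C := by
      ext p c
      simp [hψ]
    apply (TensorProduct.lid R C).injective
    rw [map_zero]
    simpa [t, hz ψ] using congr($key z)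

end BassClass

/-- The map `P^* → Hom(C, Ω_C Tr_C X)` attached to a minimal presentation of `X`. -/
def MinPres.dualMap {X : Type u} [AddCommGroup X] [Module R X] (C : Type u) [AddCommGroup C]
    [Module R C] (pres : MinPres R X) :
    Module.Dual R pres.P₀ →ₗ[R] C →ₗ[R] LinearMap.range (pres.homC C) :=
  LinearMap.smulRightₗ.compr₂ (pres.homC C).rangeRestrict

lemma MinPres.dualMap_apply {X : Type u} [AddCommGroup X] [Module R X] (C : Type u)
    [AddCommGroup C] [Module R C] (pres : MinPres R X) (θ : Module.Dual R pres.P₀) (c : C)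
    (p : pres.P₁) : (pres.dualMap C θ c : pres.P₁ →ₗ[R] C) p = θ (pres.f p) • c := rfl

lemma MinPres.mem_ker_dualMap {X : Type u} [AddCommGroup X] [Module R X] {C : Type u}
    [AddCommGroup C] [Module R C] (hC : Function.Injective (LinearMap.lsmul R C))
    (pres : MinPres R X) (θ : Module.Dual R pres.P₀) :
    θ ∈ LinearMap.ker (pres.dualMap C) ↔ ∃ ψ : X →ₗ[R] R, θ = ψ ∘ₗ pres.g := by
  constructor
  · intro hθ
    obtain ⟨ψ, hψ⟩ := exists_factor_of_ker_le pres.surj (m := θ) (by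
      rw [← pres.exact]
      rintro _ ⟨p, rfl⟩
      apply hC
      ext c
      have h0 : pres.dualMap C θ = 0 := hθ
      rw [LinearMap.lsmul_apply, ← pres.dualMap_apply C θ c p, h0]
      simp)
    exact ⟨ψ, hψ.symm⟩
  · rintro ⟨ψ, rfl⟩
    rw [LinearMap.mem_ker]
    ext c p
    have hp : pres.g (pres.f p) = 0 := by
      rw [← LinearMap.mem_ker, ← pres.exact]
      exact ⟨p, rfl⟩
    rw [pres.dualMap_apply C]
    simp [hp]

theorem MinPres.dualMap_surjective {C M : Type u} [AddCommGroup C] [Module R C] [AddCommGroup M]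
    [Module R M] (hB : MemBass R C M) (hC : Function.Bijective (LinearMap.lsmul R C))
    (hext : Subsingleton (ExtGrp R M C 1)) (pres : MinPres R (C →ₗ[R] M)) :
    Function.Surjective (pres.dualMap C) := by
  intro u
  have := pres.proj₀
  obtain ⟨a, ha⟩ := exists_smul_eq_of_homothety hC
    (((LinearMap.range (pres.homC C)).subtype ∘ₗ u).flip)
  have ha' : ∀ p c, a p • c = (u c : pres.P₁ →ₗ[R] C) p := ha
  let f' : pres.P₁ →ₗ[R] LinearMap.ker pres.g := pres.f.codRestrict _ fun p => by
    rw [← pres.exact]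
    exact ⟨p, rfl⟩
  have hf' : Function.Surjective f' := fun k => by
    obtain ⟨p, hp⟩ := pres.exact.ge k.2
    exact ⟨p, Subtype.ext hp⟩
  obtain ⟨h, hh⟩ := exists_factor_of_ker_le hf' (m := a) (by
    intro p hp
    have hp' : pres.f p = 0 := congr(($hp : pres.P₀))
    apply hC.1
    ext c
    obtain ⟨v, hv⟩ := (u c).2
    have hv' : v (pres.f p) = (u c : pres.P₁ →ₗ[R] C) p := congr($hv p)
    rw [LinearMap.lsmul_apply, ha', ← hv', hp', map_zero, map_zero, LinearMap.zero_apply])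
  obtain ⟨h', hh'⟩ := hB.exists_extend_ker hC hext pres.surj h
  refine ⟨h', ?_⟩
  ext c p
  have h1 : h (f' p) = a p := congr($hh p)
  rw [pres.dualMap_apply C, ← ha', ← h1, ← hh']
  rfl

theorem MinPres.ker_dualMap_le {C M X : Type u} [AddCommGroup C] [Module R C] [AddCommGroup M]
    [Module R M] [AddCommGroup X] [Module R X] (hR : IsSemiperfectRing R)
    (hC : Function.Injective (LinearMap.lsmul R C)) (hM : IsCStable R C M)
    (μ : X ⊗[R] C ≃ₗ[R] M) (pres : MinPres R X) :
    LinearMap.ker (pres.dualMap C) ≤ (⊥ : Ideal R).jacobson • ⊤ := by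
  intro θ hθ
  obtain ⟨ψ, rfl⟩ := (pres.mem_ker_dualMap hC θ).1 hθ
  have := pres.proj₀
  have := pres.finite₀
  obtain ⟨n, b, β, hb⟩ := exists_dual_basis (R := R) pres.P₀
  rw [← dual_eq_sum hb (ψ ∘ₗ pres.g)]
  exact Submodule.sum_mem _ fun i _ => Submodule.smul_mem_smul
    (mem_jacobson_of_isCStable hR hC hM μ ψ _) trivial

/-- The natural map `P ⊗ C → Hom(P^*, C)`. -/
def tensorToHomDual (P C : Type*) [AddCommGroup P] [Module R P] [AddCommGroup C] [Module R C] :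
    P ⊗[R] C →ₗ[R] Module.Dual R P →ₗ[R] C :=
  TensorProduct.lift (LinearMap.smulRightₗ ∘ₗ Module.Dual.eval R P)

lemma tensorToHomDual_apply {P C : Type*} [AddCommGroup P] [Module R P] [AddCommGroup C]
    [Module R C] (z : P ⊗[R] C) (θ : Module.Dual R P) :
    tensorToHomDual P C z θ = TensorProduct.lid R C (θ.rTensor C z) := by
  have : (tensorToHomDual P C).flip θ = (TensorProduct.lid R C).toLinearMap ∘ₗ θ.rTensor C := by
    ext p c
    simp [tensorToHomDual]
  exact congr($this z)

lemma tensorToHomDual_surjective {P C : Type*} [AddCommGroup P] [Module R P] [Module.Finite R P]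
    [Module.Projective R P] [AddCommGroup C] [Module R C] :
    Function.Surjective (tensorToHomDual (R := R) P C) := by
  intro u
  obtain ⟨n, b, β, hb⟩ := exists_dual_basis (R := R) P
  refine ⟨∑ i, b i ⊗ₜ u (β i), ?_⟩
  refine LinearMap.ext fun θ => ?_
  conv_rhs => rw [← dual_eq_sum hb θ, map_sum]
  simp [tensorToHomDual_apply]

/-- `M` is the image of `Hom(f', C)` whenever `f'` maps onto the kernel of
`P₀^* → Hom(C, Ω_C Tr_C Hom(C, M))`. -/
theorem MinPres.equiv_range_lcomp {C M : Type u} [AddCommGroup C] [Module R C] [AddCommGroup M]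
    [Module R M] (hC : Function.Bijective (LinearMap.lsmul R C)) (hB : MemBass R C M)
    (hsyz : IsCSyzygy R C M) (pres : MinPres R (C →ₗ[R] M)) {Q : Type*} [AddCommGroup Q]
    [Module R Q] (f' : Q →ₗ[R] Module.Dual R pres.P₀)
    (hf' : LinearMap.range f' = LinearMap.ker (pres.dualMap C)) :
    Nonempty (M ≃ₗ[R] LinearMap.range (LinearMap.lcomp R C f')) := by
  have := pres.proj₀
  have := pres.finite₀
  have hker : LinearMap.ker (TensorProduct.lift pres.g) =
      LinearMap.ker (LinearMap.lcomp R C f' ∘ₗ tensorToHomDual pres.P₀ C) := by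
    ext z
    rw [hB.mem_ker_lift_iff hC hsyz]
    constructor
    · intro hz
      rw [LinearMap.mem_ker]
      ext q
      obtain ⟨ψ, hψ⟩ := (pres.mem_ker_dualMap hC.1 _).1 (hf'.le ⟨q, rfl⟩)
      change tensorToHomDual pres.P₀ C z (f' q) = 0
      rw [tensorToHomDual_apply, hψ, hz, map_zero]
    · intro hz ψ
      obtain ⟨q, hq⟩ := hf'.ge ((pres.mem_ker_dualMap hC.1 _).2 ⟨ψ, rfl⟩)
      apply (TensorProduct.lid R C).injective
      have h1 : tensorToHomDual pres.P₀ C z (f' q) = 0 := congr($hz q)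
      rw [map_zero, ← tensorToHomDual_apply, ← h1, hq]
  obtain ⟨e⟩ := range_equiv_of_ker_eq (hB.lift_surjective pres.surj) hker
  exact ⟨e ≪≫ₗ LinearEquiv.ofEq _ _ (LinearMap.range_comp_of_range_eq_top _
    (LinearMap.range_eq_top.2 tensorToHomDual_surjective))⟩

lemma isLambdaOf_of_cover [IsNoetherianRing R] (hR : IsSemiperfectRing R) {C M N P : Type u}
    [AddCommGroup C] [Module R C] [AddCommGroup M] [Module R M] [AddCommGroup N] [Module R N]
    [AddCommGroup P] [Module R P] [Module.Finite R P] [Module.Projective R P]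
    {G : Module.Dual R P →ₗ[R] C →ₗ[R] N} (hG : Function.Surjective G)
    (hG' : LinearMap.ker G ≤ (⊥ : Ideal R).jacobson • ⊤)
    (h : ∀ (Q : ModuleCat.{u} R) (f : Q →ₗ[R] Module.Dual R P),
      LinearMap.range f = LinearMap.ker G →
        Nonempty (M ≃ₗ[R] LinearMap.range (LinearMap.lcomp R C f))) :
    IsLambdaOf R C N M := by
  obtain ⟨Q, f, hf, pres, ⟨e⟩⟩ := exists_minPres_of_cover hR hG hG' C
  obtain ⟨e'⟩ := h Q f hf
  exact ⟨pres, ⟨e' ≪≫ₗ e⟩⟩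

/-- `M` is the linkage of `Ω_C Tr_C Hom(C, M)`. -/
theorem MinPres.isLambdaOf_range [IsNoetherianRing R] (hR : IsSemiperfectRing R) {C M : Type u}
    [AddCommGroup C] [Module R C] [AddCommGroup M] [Module R M]
    (hC : Function.Bijective (LinearMap.lsmul R C)) (hB : MemBass R C M)
    (hsyz : IsCSyzygy R C M) (hM : IsCStable R C M) (hext : Subsingleton (ExtGrp R M C 1))
    (pres : MinPres R (C →ₗ[R] M)) :
    IsLambdaOf R C (LinearMap.range (pres.homC C)) M := by
  have := pres.proj₀
  have := pres.finite₀
  exact isLambdaOf_of_cover hR (pres.dualMap_surjective hB hC hext)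
    (pres.ker_dualMap_le hR hC.1 hM hB.evalEquiv) fun _ f => pres.equiv_range_lcomp hC hB hsyz f

theorem isHorizontallyLinked [IsNoetherianRing R] (hR : IsSemiperfectRing R) {C M : Type u}
    [AddCommGroup C] [Module R C] [Module.Finite R C] [AddCommGroup M] [Module R M]
    [Module.Finite R M] (hC : Function.Bijective (LinearMap.lsmul R C)) (hB : MemBass R C M)
    (hsyz : IsCSyzygy R C M) (hM : IsCStable R C M) (hext : Subsingleton (ExtGrp R M C 1)) :
    IsHorizontallyLinked R C M := by
  have := finite_linearMap (R := R) C M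
  obtain ⟨pres⟩ := nonempty_minPres hR (C →ₗ[R] M)
  exact ⟨ModuleCat.of R (LinearMap.range (pres.homC C)), ⟨pres, ⟨LinearEquiv.refl R _⟩⟩,
    pres.isLambdaOf_range hR hC hB hsyz hM hext⟩

end Linkage

end Paper

open Paper in
/-- Theorem 3.8: sufficient conditions for an `M ∈ B_C` to be
horizontally linked with respect to `C`. -/
theorem stmt_3 (R : Type u) [CommRing R] [IsNoetherianRing R]
    (hsemiperf : IsSemiperfectRing R)
    (C : Type u) [AddCommGroup C] [Module R C] (hC : IsSemidualizing R C)
    (hid : ∀ (p : Ideal R) (_ : p.IsPrime), ringDepthAt R p ≤ 1 →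
      HasFiniteInjDim (Localization.AtPrime p) (LocalizedModule p.primeCompl C))
    (M : Type u) [AddCommGroup M] [Module R M] [Module.Finite R M]
    (hB : MemBass R C M) (hsyz : IsCSyzygy R C M)
    (hstable : IsCStable R C M)
    (hsh : StableHomZero R (C →ₗ[R] M) C)
    (hext : Subsingleton (ExtGrp R M C 1)) :
    IsHorizontallyLinked R C M := by
  have := hC.1
  exact isHorizontallyLinked hsemiperf hC.2.1 hB hsyz hstable hext
end
end
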